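/- Let I ⊆ ℝ be an interval and let λ be a real number with 1/2 ≤ λ ≤ 3/5. Then the Hausdorff dimension of S_3(I,λ) is at most (4−2λ)/(3(1+λ)). -/

import Mathlib

open MeasureTheory
open scoped ENNReal

/-- Distance from a real number to the nearest integer. -/
noncomputable def distNearestInt (y : ℝ) : ℝ := |y - round y|

/-- The `n`-th simultaneous Diophantine exponent `λ_n(x) ∈ [0,∞]`: the supremum of all
`λ > 0` such that `max_{1 ≤ i ≤ n} ‖q x^i‖ ≤ q^{-λ}` holds for infinitely many positive
integers `q`. -/
noncomputable def simExponent (n : ℕ) (x : ℝ) : ℝ≥0∞ :=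
  sSup (ENNReal.ofReal '' {l : ℝ | 0 < l ∧
    {q : ℕ | 0 < q ∧
      ∀ i ∈ Finset.Icc 1 n, distNearestInt ((q : ℝ) * x ^ i) ≤ (q : ℝ) ^ (-l)}.Infinite})

/-- `S_n(I, λ) = {x ∈ I : λ_n(x) > λ}`. -/
noncomputable def SimSet (n : ℕ) (I : Set ℝ) (lam : ℝ) : Set ℝ :=
  {x ∈ I | ENNReal.ofReal lam < simExponent n x}


theorem two_point_aux2 (d s H a a' X : ℝ) (hH : 0 ≤ H)
    (kabs : s * d * (a * a') ≤ H*a^2+H*a'^2) (p1 : 0 < a) (p2 : 0 < a') (hX : 0 < X)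
    (u1 : X ≤ a^3) (u2 : a^3 ≤ 6*X) (u1' : X ≤ a'^3) (u2' : a'^3 ≤ 6*X) : d * s ≤ 4*H := by
  have t1 : a ≤ 2*a' := by
    by_contra hc; push Not at hc
    have : (2*a')^3 < a^3 := pow_lt_pow_left₀ hc (by positivity) (by norm_num)
    rw [mul_pow] at this
    linarith
  have t2 : a' ≤ 2*a := by
    by_contra hc; push Not at hc
    have : (2*a)^3 < a'^3 := pow_lt_pow_left₀ hc (by positivity) (by norm_num)
    rw [mul_pow] at this
    linarith
  have : d*s * (a*a') ≤ 4*H*(a*a') := by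
    have h1 := mul_nonneg (sub_nonneg.2 t1) (sub_nonneg.2 t2)
    have h2 : 0 < a*a' := by positivity
    have : a^2+a'^2 ≤ 4*(a*a') := by nlinarith
    have := mul_le_mul_of_nonneg_left this hH
    linarith
  exact le_of_mul_le_mul_right this (by positivity)

theorem two_point_aux (J q h s Q H : ℝ) (syz : J^2 = q^2*s^2-4*h^3) (g : |h| ≤ H) (hQ : 0 < Q)
    (hHQ : 4*H^3 ≤ Q^2) (hs1 : 1 ≤ s^2) (e1 : Q ≤ q) (e2 : q ≤ 2*Q) (j : 0 ≤ s * J) :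
    |s| * Q ≤ |J + s*q| ∧ |J + s*q| ≤ 6*(|s| * Q) := by
  have hspos : 0 < |s| := by
    rw [abs_pos]; rintro rfl; norm_num at hs1
  have hh : -H^3 ≤ h^3 := by
    have h1 := (abs_le.1 g).1
    have h2 : (-H)^3 ≤ h^3 := (Odd.strictMono_pow (R := ℝ) (n := 3) (by decide)).monotone h1
    nlinarith
  have hq : 0 < q := by linarith
  have hq2 : Q^2 ≤ q^2*s^2 := by
    have : Q^2 ≤ q^2 := by nlinarith
    nlinarith [sq_nonneg q]
  have hJ : |J| ≤ 2*(|s| * q) := by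
    have h0 : 0 ≤ 2*(|s| * q) := by positivity
    refine abs_le_of_sq_le_sq ?_ h0
    have : (2*(|s| * q))^2 = 4*(q^2*s^2) := by rw [mul_pow, mul_pow, sq_abs]; ring
    rw [this, syz]; nlinarith
  have habs : |J + s*q| = |J| + |s| * q := by
    rcases lt_or_ge s 0 with hs0 | hs0
    · have : J ≤ 0 := by by_contra hc; push Not at hc; nlinarith
      rw [abs_of_nonpos this, abs_of_neg hs0, abs_of_nonpos (by nlinarith)]; ring
    · have hs0' : 0 < s := lt_of_le_of_ne hs0 (by rintro rfl; simp at hspos)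
      have : 0 ≤ J := by by_contra hc; push Not at hc; nlinarith
      rw [abs_of_nonneg this, abs_of_pos hs0', abs_of_nonneg (by positivity)]
  rw [habs]
  have h3 : |s| * Q ≤ |s| * q := by gcongr
  have h4 : |s| * q ≤ |s| * (2*Q) := by gcongr
  constructor
  · linarith [abs_nonneg J]
  · linarith [abs_nonneg J]

set_option maxHeartbeats 2000000 in
theorem two_point (F0 F1 F2 F3 s m n m' n' Q H : ℝ)
    (hs : s^2 = (F0*F3-F1*F2)^2 - 4*(F0*F2-F1^2)*(F1*F3-F2^2))
    (hs1 : 1 ≤ s^2) (hQ : 0 < Q) (hHQ : 4*H^3 ≤ Q^2)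
    (e1 : Q ≤ F0*m^3+3*F1*m^2*n+3*F2*m*n^2+F3*n^3)
    (e2 : F0*m^3+3*F1*m^2*n+3*F2*m*n^2+F3*n^3 ≤ 2*Q)
    (e1' : Q ≤ F0*m'^3+3*F1*m'^2*n'+3*F2*m'*n'^2+F3*n'^3)
    (e2' : F0*m'^3+3*F1*m'^2*n'+3*F2*m'*n'^2+F3*n'^3 ≤ 2*Q)
    (g : |(F0*F2-F1^2)*m^2+(F0*F3-F1*F2)*m*n+(F1*F3-F2^2)*n^2| ≤ H)
    (g' : |(F0*F2-F1^2)*m'^2+(F0*F3-F1*F2)*m'*n'+(F1*F3-F2^2)*n'^2| ≤ H)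
    (j : 0 ≤ s * (((F0*F3-F1*F2)*F0-2*(F0*F2-F1^2)*F1)*m^3
      + 3*((F0*F3-F1*F2)*F1-2*(F0*F2-F1^2)*F2)*m^2*n
      + 3*((F0*F3-F1*F2)*F2-2*(F0*F2-F1^2)*F3)*m*n^2
      + (2*(F1*F3-F2^2)*F2-(F0*F3-F1*F2)*F3)*n^3))
    (j' : 0 ≤ s * (((F0*F3-F1*F2)*F0-2*(F0*F2-F1^2)*F1)*m'^3
      + 3*((F0*F3-F1*F2)*F1-2*(F0*F2-F1^2)*F2)*m'^2*n'
      + 3*((F0*F3-F1*F2)*F2-2*(F0*F2-F1^2)*F3)*m'*n'^2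
      + (2*(F1*F3-F2^2)*F2-(F0*F3-F1*F2)*F3)*n'^3)) :
    |m*n'-m'*n| * |s| ≤ 4*H := by
  have hcube : ∀ b : ℝ, ∃ l : ℝ, l^3 = b := fun b => by
    rcases le_total 0 b with h | h
    · exact ⟨b ^ ((1:ℝ)/3), by rw [← Real.rpow_natCast, ← Real.rpow_mul h]; norm_num⟩
    · refine ⟨-((-b) ^ ((1:ℝ)/3)), ?_⟩
      have : ((-b) ^ ((1:ℝ)/3))^3 = -b := by
        rw [← Real.rpow_natCast, ← Real.rpow_mul (by linarith)]; norm_num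
      linear_combination -this
  obtain ⟨A, hA⟩ : ∃ A, A = F0*F2-F1^2 := ⟨_, rfl⟩
  obtain ⟨B, hB⟩ : ∃ A, A = F0*F3-F1*F2 := ⟨_, rfl⟩
  obtain ⟨C, hC⟩ : ∃ A, A = F1*F3-F2^2 := ⟨_, rfl⟩
  obtain ⟨b0, hb0⟩ : ∃ b, b = B*F0-2*A*F1 + s*F0 := ⟨_, rfl⟩
  obtain ⟨b1, hb1⟩ : ∃ b, b = B*F1-2*A*F2 + s*F1 := ⟨_, rfl⟩
  obtain ⟨b2, hb2⟩ : ∃ b, b = B*F2-2*A*F3 + s*F2 := ⟨_, rfl⟩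
  obtain ⟨b3, hb3⟩ : ∃ b, b = 2*C*F2-B*F3 + s*F3 := ⟨_, rfl⟩
  have k1 : b0*b2 = b1^2 := by
    rw [hb0, hb1, hb2, hA, hB]; linear_combination (F0*F2-F1^2)*hs
  have k2 : b0*b3 = b1*b2 := by
    rw [hb0, hb1, hb2, hb3, hA, hB, hC]; linear_combination (F0*F3-F1*F2)*hs
  have k3 : b1*b3 = b2^2 := by
    rw [hb1, hb2, hb3, hA, hB, hC]; linear_combination (F1*F3-F2^2)*hs
  have r0 : s*b0 = B*b0-2*A*b1 := by
    rw [hb0, hb1, hA, hB]; linear_combination F0*hs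
  have r1 : s*b1 = 2*C*b0-B*b1 := by
    rw [hb0, hb1, hA, hB, hC]; linear_combination F1*hs
  have r2 : s*b2 = B*b2-2*A*b3 := by
    rw [hb2, hb3, hA, hB, hC]; linear_combination F2*hs
  have r3 : s*b3 = 2*C*b2-B*b3 := by
    rw [hb2, hb3, hA, hB, hC]; linear_combination F3*hs
  obtain ⟨l, l', c0, c1, c2, c3⟩ : ∃ l l' : ℝ, b0 = l^3 ∧ b1 = l^2*l' ∧ b2 = l*l'^2 ∧ b3 = l'^3 := by
    by_cases hz : b0 = 0
    · have z1 : b1 = 0 := by rw [hz, zero_mul] at k1; exact pow_eq_zero_iff (two_ne_zero) |>.1 k1.symm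
      have z2 : b2 = 0 := by rw [z1, zero_mul] at k3; exact pow_eq_zero_iff (two_ne_zero) |>.1 k3.symm
      obtain ⟨l', hl⟩ := hcube b3
      exact ⟨0, l', by simp [hz], by simp [z1], by simp [z2], hl.symm⟩
    · obtain ⟨l, hl⟩ := hcube b0
      have hl0 : l ≠ 0 := by rintro rfl; apply hz; rw [← hl]; norm_num
      refine ⟨l, b1/l^2, hl.symm, by field_simp, ?_, ?_⟩
      · field_simp; rw [← hl] at k1
        have : l^3 * b2 = b1^2 := k1
        linear_combination this
      · field_simp
        have h1 : b2 * l^3 = b1^2 := by rw [hl]; linarith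
        have h2 : l^3*b3 = b1*b2 := by rw [hl]; linarith
        linear_combination l^3*h2 + b1*h1
  have q0 : s*l = B*l-2*A*l' := by
    by_cases hl : l = 0
    · by_cases hl' : l' = 0
      · simp [hl, hl']
      · rw [c2, c3] at r2
        have : l'^2 * (s*l) = l'^2 * (B*l-2*A*l') := by linear_combination r2
        exact mul_left_cancel₀ (pow_ne_zero 2 hl') this
    · rw [c0, c1] at r0
      have : l^2 * (s*l) = l^2 * (B*l-2*A*l') := by linear_combination r0
      exact mul_left_cancel₀ (pow_ne_zero 2 hl) this
  have q1 : s*l' = 2*C*l-B*l' := by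
    by_cases hl : l = 0
    · by_cases hl' : l' = 0
      · simp [hl, hl']
      · rw [c2, c3] at r3
        have : l'^2 * (s*l') = l'^2 * (2*C*l-B*l') := by linear_combination r3
        exact mul_left_cancel₀ (pow_ne_zero 2 hl') this
    · rw [c0, c1] at r1
      have : l^2 * (s*l') = l^2 * (2*C*l-B*l') := by linear_combination r1
      exact mul_left_cancel₀ (pow_ne_zero 2 hl) this
  have hspos : 0 < |s| := by
    rw [abs_pos]; rintro rfl; norm_num at hs1
  have bd : ∀ m n : ℝ, Q ≤ F0*m^3+3*F1*m^2*n+3*F2*m*n^2+F3*n^3 →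
     F0*m^3+3*F1*m^2*n+3*F2*m*n^2+F3*n^3 ≤ 2*Q →
     |(F0*F2-F1^2)*m^2+(F0*F3-F1*F2)*m*n+(F1*F3-F2^2)*n^2| ≤ H →
     0 ≤ s * (((F0*F3-F1*F2)*F0-2*(F0*F2-F1^2)*F1)*m^3
      + 3*((F0*F3-F1*F2)*F1-2*(F0*F2-F1^2)*F2)*m^2*n
      + 3*((F0*F3-F1*F2)*F2-2*(F0*F2-F1^2)*F3)*m*n^2
      + (2*(F1*F3-F2^2)*F2-(F0*F3-F1*F2)*F3)*n^3) →
     |s| *Q ≤ |l*m+l'*n|^3 ∧ |l*m+l'*n|^3 ≤ 6*(|s| *Q) := by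
    intro m n e1 e2 g j
    have syz : (((F0*F3-F1*F2)*F0-2*(F0*F2-F1^2)*F1)*m^3
      + 3*((F0*F3-F1*F2)*F1-2*(F0*F2-F1^2)*F2)*m^2*n
      + 3*((F0*F3-F1*F2)*F2-2*(F0*F2-F1^2)*F3)*m*n^2
      + (2*(F1*F3-F2^2)*F2-(F0*F3-F1*F2)*F3)*n^3)^2 =
      (F0*m^3+3*F1*m^2*n+3*F2*m*n^2+F3*n^3)^2*s^2
      - 4*((F0*F2-F1^2)*m^2+(F0*F3-F1*F2)*m*n+(F1*F3-F2^2)*n^2)^3 := by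
      rw [hs]; ring
    have hW : (l*m+l'*n)^3 = (((F0*F3-F1*F2)*F0-2*(F0*F2-F1^2)*F1)*m^3
      + 3*((F0*F3-F1*F2)*F1-2*(F0*F2-F1^2)*F2)*m^2*n
      + 3*((F0*F3-F1*F2)*F2-2*(F0*F2-F1^2)*F3)*m*n^2
      + (2*(F1*F3-F2^2)*F2-(F0*F3-F1*F2)*F3)*n^3) + s*(F0*m^3+3*F1*m^2*n+3*F2*m*n^2+F3*n^3) := by
      have : (l*m+l'*n)^3 = b0*m^3+3*b1*m^2*n+3*b2*m*n^2+b3*n^3 := by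
        rw [c0, c1, c2, c3]; ring
      rw [this, hb0, hb1, hb2, hb3, hA, hB, hC]; ring
    rw [← abs_pow, hW]
    generalize (((F0*F3-F1*F2)*F0-2*(F0*F2-F1^2)*F1)*m^3
      + 3*((F0*F3-F1*F2)*F1-2*(F0*F2-F1^2)*F2)*m^2*n
      + 3*((F0*F3-F1*F2)*F2-2*(F0*F2-F1^2)*F3)*m*n^2
      + (2*(F1*F3-F2^2)*F2-(F0*F3-F1*F2)*F3)*n^3) = J at *
    generalize F0*m^3+3*F1*m^2*n+3*F2*m*n^2+F3*n^3 = q at *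
    generalize (F0*F2-F1^2)*m^2+(F0*F3-F1*F2)*m*n+(F1*F3-F2^2)*n^2 = h at *
    exact two_point_aux J q h s Q H syz g hQ hHQ hs1 e1 e2 j
  obtain ⟨u1, u2⟩ := bd m n e1 e2 g j
  obtain ⟨u1', u2'⟩ := bd m' n' e1' e2' g' j'
  have hx : 0 < |s| *Q := by positivity
  have key : (A*m'^2+B*m'*n'+C*n'^2)*(l*m+l'*n)^2 - (A*m^2+B*m*n+C*n^2)*(l*m'+l'*n')^2
     = s*(m*n'-m'*n)*((l*m+l'*n)*(l*m'+l'*n')) := by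
    linear_combination (-(m*n'-m'*n))*((l*m*m'+ l'*(m'*n+m*n')/2)*q0 + (l'*n*n' + l*(m'*n+m*n')/2)*q1)
  rw [← hA, ← hB, ← hC] at g g'
  generalize A*m'^2+B*m'*n'+C*n'^2 = h' at *
  generalize A*m^2+B*m*n+C*n^2 = h at *
  have kabs : |s| *|m*n'-m'*n| *(|l*m+l'*n| *|l*m'+l'*n'|) ≤ H*|l*m+l'*n|^2+H*|l*m'+l'*n'|^2 := by
    rw [← abs_mul, ← abs_mul, ← abs_mul, ← key]
    calc _ ≤ |h'*(l*m+l'*n)^2| + |h*(l*m'+l'*n')^2| := abs_sub _ _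
      _ ≤ _ := by
        rw [abs_mul, abs_mul, abs_pow, abs_pow]; gcongr
  have p1 : 0 < |l*m+l'*n| := by
    by_contra hc; have : |l*m+l'*n| = 0 := le_antisymm (not_lt.1 hc) (abs_nonneg _)
    rw [this] at u1; norm_num at u1; linarith
  have p2 : 0 < |l*m'+l'*n'| := by
    by_contra hc; have : |l*m'+l'*n'| = 0 := le_antisymm (not_lt.1 hc) (abs_nonneg _)
    rw [this] at u1'; norm_num at u1'; linarith
  have hH : 0 ≤ H := (abs_nonneg _).trans g
  exact two_point_aux2 _ _ _ _ _ _ hH kabs p1 p2 hx u1 u2 u1' u2'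


/-- real harmonic sum -/
noncomputable def hSum (N : ℕ) : ℝ := ∑ i ∈ Finset.range N, 1 / ((i : ℝ) + 1)

theorem hSum_le (N : ℕ) : hSum N ≤ 1 + Real.log N := by
  have := harmonic_le_one_add_log N
  simpa [hSum, harmonic] using this

theorem hSum_nonneg (N : ℕ) : 0 ≤ hSum N := by
  unfold hSum; positivity

/-- summing bounds over fibres of a `ℕ`-valued map -/
theorem card_le_fib {α : Type*} [DecidableEq α] (V : Finset α) (f : α → ℕ) (N : ℕ) (hf : ∀ v ∈ V, f v ≤ N)
    (c0 a b : ℝ) (h0 : ((V.filter (fun v => f v = 0)).card : ℝ) ≤ c0)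
    (h1 : ∀ k : ℕ, 1 ≤ k → k ≤ N → ((V.filter (fun v => f v = k)).card : ℝ) ≤ a / k + b) :
    (V.card : ℝ) ≤ c0 + a * hSum N + b * N := by
  have h := Finset.card_eq_sum_card_fiberwise (f := f) (s := V) (t := Finset.range (N+1))
    (fun v hv => by simpa [Nat.lt_succ_iff] using hf v hv)
  rw [h, Finset.sum_range_succ']
  push_cast
  have : ∑ k ∈ Finset.range N, ((V.filter (fun v => f v = k+1)).card : ℝ)
      ≤ ∑ k ∈ Finset.range N, (a * (1 / ((k:ℝ)+1)) + b) := by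
    apply Finset.sum_le_sum
    intro k hk
    have := h1 (k+1) (by omega) (by simpa [Nat.succ_le_iff] using hk)
    push_cast at this
    rw [mul_one_div]; exact this
  rw [Finset.sum_add_distrib, ← Finset.mul_sum] at this
  simp only [Finset.sum_const, Finset.card_range, nsmul_eq_mul] at this
  unfold hSum
  linarith

theorem card_Icc_le (S : Finset ℤ) (k : ℕ) (h : ∀ j ∈ S, |j| ≤ k) : S.card ≤ 2*k+1 := by
  have : S ⊆ Finset.Icc (-(k:ℤ)) k := fun j hj => by
    rw [Finset.mem_Icc]; exact abs_le.1 (h j hj)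
  refine (Finset.card_le_card this).trans ?_
  simp; omega

theorem abs_le_div {j k : ℤ} {N : ℕ} (hk : 1 ≤ k.natAbs) (h : |j * k| ≤ N) :
    |j| ≤ (N / k.natAbs : ℕ) := by
  have h2 : j.natAbs * k.natAbs ≤ N := by
    rw [← Int.natAbs_mul]; rw [Int.abs_eq_natAbs] at h; exact_mod_cast h
  have : j.natAbs ≤ N / k.natAbs := (Nat.le_div_iff_mul_le (by omega)).2 h2
  rw [Int.abs_eq_natAbs]; exact_mod_cast this

theorem vec_fib (V : Finset (ℤ × ℤ)) (N : ℕ) (v0 : ℤ × ℤ) (hv0 : IsCoprime v0.1 v0.2)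
    (hd : ∀ v ∈ V, ∀ w ∈ V, |v.1 * w.2 - w.1 * v.2| ≤ N) (k : ℤ) (hk : 1 ≤ k.natAbs) :
    (V.filter (fun v => v0.1 * v.2 - v.1 * v0.2 = k)).card ≤ 2 * (N / k.natAbs) + 1 := by
  obtain ⟨r, t, hrt⟩ := hv0
  rcases (V.filter (fun v => v0.1 * v.2 - v.1 * v0.2 = k)).eq_empty_or_nonempty with he | ⟨w, hw⟩
  · rw [he]; simp
  rw [Finset.mem_filter] at hw
  have rep : ∀ v ∈ V.filter (fun v => v0.1 * v.2 - v.1 * v0.2 = k),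
      v.1 = w.1 + (r*(v.1-w.1)+t*(v.2-w.2)) * v0.1 ∧ v.2 = w.2 + (r*(v.1-w.1)+t*(v.2-w.2)) * v0.2 := by
    intro v hv
    rw [Finset.mem_filter] at hv
    have e : v0.1 * (v.2-w.2) = v0.2 * (v.1-w.1) := by linear_combination hv.2 - hw.2
    constructor
    · linear_combination (-(v.1-w.1))*hrt - t*e
    · linear_combination (-(v.2-w.2))*hrt + r*e
  rw [← Finset.card_image_of_injOn (f := fun v : ℤ × ℤ => r*(v.1-w.1)+t*(v.2-w.2))]
  · apply card_Icc_le
    intro j hj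
    obtain ⟨v, hv, rfl⟩ := Finset.mem_image.1 hj
    apply abs_le_div hk
    obtain ⟨a1, a2⟩ := rep v hv
    rw [Finset.mem_filter] at hv
    have := hd v hv.1 w hw.1
    convert this using 2
    linear_combination (-(r*(v.1-w.1)+t*(v.2-w.2)))*hw.2 - w.2*a1 + w.1*a2
  · intro v hv v' hv' hvv
    obtain ⟨a1, a2⟩ := rep v hv
    obtain ⟨a1', a2'⟩ := rep v' hv'
    simp only at hvv
    rw [hvv] at a1 a2
    exact Prod.ext (a1.trans a1'.symm) (a2.trans a2'.symm)

theorem vec_count (V : Finset (ℤ × ℤ)) (N : ℕ) (hc : ∀ v ∈ V, IsCoprime v.1 v.2)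
    (hd : ∀ v ∈ V, ∀ w ∈ V, |v.1 * w.2 - w.1 * v.2| ≤ N) :
    (V.card : ℝ) ≤ 2 + 4 * N * hSum N + 2 * N := by
  rcases V.eq_empty_or_nonempty with he | ⟨v0, hv0⟩
  · rw [he]; simp; have := hSum_nonneg N; positivity
  apply card_le_fib V (fun v => (v0.1 * v.2 - v.1 * v0.2).natAbs) N
  · intro v hv
    have := hd v0 hv0 v hv
    rw [Int.abs_eq_natAbs] at this; exact_mod_cast this
  · have : V.filter (fun v => (v0.1 * v.2 - v.1 * v0.2).natAbs = 0) ⊆ {v0, (-v0.1, -v0.2)} := by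
      intro v hv
      rw [Finset.mem_filter, Int.natAbs_eq_zero] at hv
      obtain ⟨r, t, hrt⟩ := hc v0 hv0
      obtain ⟨r', t', hrt'⟩ := hc v hv.1
      have a1 : v.1 = (r*v.1+t*v.2)*v0.1 := by linear_combination (-v.1)*hrt - t*hv.2
      have a2 : v.2 = (r*v.1+t*v.2)*v0.2 := by linear_combination (-v.2)*hrt + r*hv.2
      have hu : IsUnit (r*v.1+t*v.2) := by
        apply IsUnit.of_mul_eq_one (r'*v0.1+t'*v0.2)
        linear_combination hrt' - r'*a1 - t'*a2
      rw [Finset.mem_insert, Finset.mem_singleton]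
      rcases Int.isUnit_iff.1 hu with h | h
      · left; rw [h] at a1 a2; exact Prod.ext (by simpa using a1) (by simpa using a2)
      · right; rw [h] at a1 a2; exact Prod.ext (by simpa using a1) (by simpa using a2)
    have := (Finset.card_le_card this).trans Finset.card_le_two
    exact_mod_cast this
  · intro k hk1 hkN
    have hsub : V.filter (fun v => (v0.1 * v.2 - v.1 * v0.2).natAbs = k) ⊆
        V.filter (fun v => v0.1 * v.2 - v.1 * v0.2 = k) ∪
        V.filter (fun v => v0.1 * v.2 - v.1 * v0.2 = -(k:ℤ)) := by
      intro v hv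
      rw [Finset.mem_union, Finset.mem_filter, Finset.mem_filter]
      rw [Finset.mem_filter] at hv
      rcases Int.natAbs_eq (v0.1 * v.2 - v.1 * v0.2) with h | h
      · left; exact ⟨hv.1, by rw [h, hv.2]⟩
      · right; exact ⟨hv.1, by rw [h, hv.2]⟩
    have h1 := vec_fib V N v0 (hc v0 hv0) hd k (by simpa using hk1)
    have h2 := vec_fib V N v0 (hc v0 hv0) hd (-k) (by simpa using hk1)
    simp only [Int.natAbs_neg, Int.natAbs_natCast] at h1 h2
    have h3 := (Finset.card_le_card hsub).trans (Finset.card_union_le _ _)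
    have h4 : (V.filter (fun v => (v0.1 * v.2 - v.1 * v0.2).natAbs = k)).card ≤ 4 * (N/k) + 2 := by omega
    have h5 : ((N/k : ℕ):ℝ) ≤ N/k := Nat.cast_div_le
    have h6 : ((V.filter (fun v => (v0.1 * v.2 - v.1 * v0.2).natAbs = k)).card:ℝ) ≤ 4 * (N/k : ℕ) + 2 := by exact_mod_cast h4
    calc _ ≤ _ := h6
      _ ≤ 4 * ((N:ℝ)/k) + 2 := by gcongr
      _ = _ := by ring

/-- pairs with small product -/
noncomputable def gSet (N : ℕ) : Finset (ℤ × ℤ) :=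
  (Finset.Icc (-(N:ℤ)) N ×ˢ Finset.Icc (-(N:ℤ)) N).filter (fun u => |u.1 * u.2| ≤ N)

theorem natAbs_fib_sub (k : ℕ) (S : Finset ℤ) (h : ∀ j ∈ S, j.natAbs = k) : S.card ≤ 2 := by
  have : S ⊆ {(k:ℤ), -(k:ℤ)} := by
    intro j hj
    have := h j hj
    rw [Finset.mem_insert, Finset.mem_singleton]; omega
  exact (Finset.card_le_card this).trans Finset.card_le_two

theorem gSet_card (N : ℕ) : ((gSet N).card : ℝ) ≤ 1 + 4 * N * hSum N + 4 * N := by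
  have : ((gSet N).card : ℝ) ≤ (2*N+1) + 4 * N * hSum N + 2 * N := by
    apply card_le_fib (gSet N) (fun v => v.1.natAbs) N
    · intro v hv
      simp only [gSet, Finset.mem_filter, Finset.mem_product, Finset.mem_Icc] at hv
      omega
    · have : (gSet N).filter (fun v => v.1.natAbs = 0) ⊆ {0} ×ˢ Finset.Icc (-(N:ℤ)) N := by
        intro v hv
        simp only [gSet, Finset.mem_filter, Finset.mem_product, Finset.mem_Icc, Finset.mem_singleton] at hv ⊢
        omega
      have := Finset.card_le_card this
      rw [Finset.card_product] at this
      simp only [Finset.card_singleton, Int.card_Icc] at this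
      have h2 : ((gSet N).filter (fun v => v.1.natAbs = 0)).card ≤ 2*N+1 := by omega
      exact_mod_cast h2
    · intro k hk1 hkN
      have : (gSet N).filter (fun v => v.1.natAbs = k) ⊆
          ({(k:ℤ), -(k:ℤ)} : Finset ℤ) ×ˢ Finset.Icc (-((N/k : ℕ):ℤ)) (N/k : ℕ) := by
        intro v hv
        simp only [gSet, Finset.mem_filter, Finset.mem_product, Finset.mem_Icc, Finset.mem_insert,
          Finset.mem_singleton] at hv ⊢
        refine ⟨by omega, ?_⟩
        have := abs_le_div (j := v.2) (k := v.1) (N := N) (by omega) (by rw [mul_comm]; exact hv.1.2)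
        rw [hv.2] at this
        exact abs_le.1 this
      have := Finset.card_le_card this
      rw [Finset.card_product] at this
      have c2 : ({(k:ℤ), -(k:ℤ)} : Finset ℤ).card ≤ 2 := Finset.card_le_two
      have c3 : (Finset.Icc (-((N/k : ℕ):ℤ)) (N/k : ℕ)).card = 2*(N/k)+1 := by
        rw [Int.card_Icc]; omega
      rw [c3] at this
      have h4 : ((gSet N).filter (fun v => v.1.natAbs = k)).card ≤ 4 * (N/k) + 2 := by nlinarith
      have h5 : ((N/k : ℕ):ℝ) ≤ N/k := Nat.cast_div_le
      have h6 : (((gSet N).filter (fun v => v.1.natAbs = k)).card:ℝ) ≤ 4 * (N/k : ℕ) + 2 := by exact_mod_cast h4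
      calc _ ≤ _ := h6
        _ ≤ 4 * ((N:ℝ)/k) + 2 := by gcongr
        _ = _ := by ring
  linarith

/-- reduced forms with vanishing leading coefficient -/
noncomputable def zSet (M : ℕ) : Finset (ℤ × ℤ × ℤ) :=
  (Finset.Icc (-(M:ℤ)) M ×ˢ Finset.Icc (-(M:ℤ)) M ×ˢ
    Finset.Icc (-(2*(M:ℤ)^4)) (2*(M:ℤ)^4)).filter
    (fun u => u.1 ≠ 0 ∧ |u.2.1| ≤ |u.1| ∧ |u.2.2| * |u.1|^3 ≤ 2*(M:ℤ)^4)

theorem zSet_card (M : ℕ) : ((zSet M).card : ℝ) ≤ 24 * M^4 * hSum M + 6 * M * M := by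
  have : ((zSet M).card : ℝ) ≤ 0 + 24 * M^4 * hSum M + 6 * M * M := by
    apply card_le_fib (zSet M) (fun v => v.1.natAbs) M
    · intro v hv
      simp only [zSet, Finset.mem_filter, Finset.mem_product, Finset.mem_Icc] at hv
      omega
    · have : (zSet M).filter (fun v => v.1.natAbs = 0) = ∅ := by
        apply Finset.filter_eq_empty_iff.2
        intro v hv
        simp only [zSet, Finset.mem_filter] at hv
        have := hv.2.1
        omega
      rw [this]; simp
    · intro k hk1 hkM
      have : (zSet M).filter (fun v => v.1.natAbs = k) ⊆
          ({(k:ℤ), -(k:ℤ)} : Finset ℤ) ×ˢ Finset.Icc (-(k:ℤ)) k ×ˢ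
            Finset.Icc (-((2*M^4/k^3 : ℕ):ℤ)) (2*M^4/k^3 : ℕ) := by
        intro v hv
        simp only [zSet, Finset.mem_filter, Finset.mem_product, Finset.mem_Icc, Finset.mem_insert,
          Finset.mem_singleton] at hv ⊢
        obtain ⟨⟨-, h1, h2, h3⟩, h4⟩ := hv
        have h5 : |v.1| = k := by rw [Int.abs_eq_natAbs, h4]
        rw [h5] at h2 h3
        refine ⟨by omega, abs_le.1 h2, ?_⟩
        have := abs_le_div (j := v.2.2) (k := (k:ℤ)^3) (N := 2*M^4)
          (by rw [Int.natAbs_pow, Int.natAbs_natCast]; exact Nat.one_le_pow _ _ hk1)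
          (by rw [abs_mul, abs_of_nonneg (a := (k:ℤ)^3) (by positivity)]; exact_mod_cast h3)
        rw [Int.natAbs_pow, Int.natAbs_natCast] at this
        exact abs_le.1 this
      have := Finset.card_le_card this
      rw [Finset.card_product, Finset.card_product] at this
      have c2 : ({(k:ℤ), -(k:ℤ)} : Finset ℤ).card ≤ 2 := Finset.card_le_two
      have c3 : (Finset.Icc (-((2*M^4/k^3 : ℕ):ℤ)) (2*M^4/k^3 : ℕ)).card = 2*(2*M^4/k^3)+1 := by
        rw [Int.card_Icc]; omega
      have c4 : (Finset.Icc (-(k:ℤ)) k).card = 2*k+1 := by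
        rw [Int.card_Icc]; omega
      rw [c3, c4] at this
      have h4 : ((zSet M).filter (fun v => v.1.natAbs = k)).card ≤ 2*((3*k) * (2*(2*M^4/k^3)+1)) := by
        refine this.trans ?_
        gcongr
        omega
      have h5 : ((2*M^4/k^3 : ℕ):ℝ) ≤ (2*M^4)/k^3 := by
        have := Nat.cast_div_le (α := ℝ) (m := 2*M^4) (n := k^3)
        push_cast at this; exact this
      have h6 : (((zSet M).filter (fun v => v.1.natAbs = k)).card:ℝ) ≤ 2*((3*k) * (2*(2*M^4/k^3 : ℕ)+1)) := by exact_mod_cast h4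
      have hk : (1:ℝ) ≤ k := by exact_mod_cast hk1
      have hkM' : (k:ℝ) ≤ M := by exact_mod_cast hkM
      calc _ ≤ _ := h6
        _ ≤ 2*((3*k) * (2*((2*M^4)/k^3)+1)) := by gcongr
        _ = 24*M^4/k^2 + 6*k := by field_simp; ring
        _ ≤ 24*M^4/k + 6*M := by
          gcongr
          nlinarith
  linarith


theorem geom_red (ξ T : ℝ) (hT : 1 ≤ T) : ∃ (a b a' b' : ℤ) (z : ℝ), 0 < z ∧ z ≤ 1 ∧
    a'*b-a*b' = 1 ∧ |(a:ℝ)| ≤ T*z ∧ |a*ξ-b| ≤ z/T ∧ |(a':ℝ)| ≤ T*(2/z) ∧ |a'*ξ-b'| ≤ (2/z)/T := by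
  have hT0 : 0 < T := by linarith
  have hn : 0 < ⌊T⌋₊ := Nat.floor_pos.2 hT
  obtain ⟨r, hr1, hr2⟩ := Real.exists_rat_abs_sub_le_and_den_le ξ hn
  have hden : (0:ℝ) < r.den := by exact_mod_cast r.den_pos
  have haT : (r.den : ℝ) ≤ T := (Nat.cast_le.2 hr2).trans (Nat.floor_le hT0.le)
  have hδ : |(r.den:ℝ)*ξ - r.num| ≤ 1/T := by
    have e : (r.den:ℝ)*ξ - r.num = r.den * (ξ - r) := by
      have : (r:ℝ) = r.num / r.den := Rat.cast_def r
      rw [this]; field_simp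
    rw [e, abs_mul, abs_of_pos hden]
    calc _ ≤ (r.den:ℝ) * (1 / ((⌊T⌋₊ + 1) * r.den)) := by gcongr
      _ = 1 / (⌊T⌋₊ + 1) := by field_simp
      _ ≤ 1/T := by
        apply one_div_le_one_div_of_le hT0
        exact (Nat.lt_floor_add_one T).le
  have hcop : IsCoprime r.num (r.den:ℤ) := by
    rw [Int.isCoprime_iff_nat_coprime]; simpa using r.reduced
  obtain ⟨u, v, huv⟩ := hcop
  generalize hb : r.num = b at *
  obtain ⟨a, ha⟩ : ∃ a : ℤ, a = r.den := ⟨_, rfl⟩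
  have haR : (r.den : ℝ) = a := by rw [ha]; simp
  rw [← ha] at huv
  rw [haR] at hden haT hδ
  clear hr1 hr2
  obtain ⟨δ, hδe⟩ : ∃ δ : ℝ, δ = a*ξ - b := ⟨_, rfl⟩
  rw [← hδe] at hδ
  have hTδ : T*|δ| ≤ 1 := by rw [le_div_iff₀ hT0] at hδ; linarith
  rcases le_total (T*|δ|) (a/T) with hc | hc
  · -- choose the second vector reduced
    have ha0 : 0 < a := by exact_mod_cast hden
    obtain ⟨z, hz⟩ : ∃ z : ℝ, z = a/T := ⟨_, rfl⟩
    have hz0 : 0 < z := by rw [hz]; positivity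
    have hz1 : z ≤ 1 := by rw [hz, div_le_one hT0]; exact haT
    have haz : (a:ℝ) = T*z := by rw [hz]; field_simp
    have hm1 : 0 ≤ u % a := Int.emod_nonneg _ ha0.ne'
    have hm2 : u % a < a := Int.emod_lt_of_pos _ ha0
    have hm3 : u % a = u - a * (u / a) := by have := Int.emod_add_mul_ediv u a; linarith
    generalize u % a = a' at *
    obtain ⟨b', hb'⟩ : ∃ b', b' = -v - b*(u/a) := ⟨_, rfl⟩
    have hdet : a'*b-a*b' = 1 := by rw [hm3, hb']; linear_combination huv
    have hm1R : (0:ℝ) ≤ a' := by exact_mod_cast hm1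
    have hm2R : (a':ℝ) ≤ a := by exact_mod_cast hm2.le
    have hinv : 1 ≤ 1/z := by rw [le_div_iff₀ hz0]; linarith
    refine ⟨a, b, a', b', z, hz0, hz1, hdet, ?_, ?_, ?_, ?_⟩
    · rw [abs_of_pos hden, haz]
    · rw [← hδe, le_div_iff₀ hT0, hz]; linarith
    · rw [abs_of_nonneg hm1R]
      have : 1 ≤ 2/z := by rw [le_div_iff₀ hz0]; linarith
      nlinarith
    · have hd : (a:ℝ)*(a'*ξ-b') = 1 + a'*δ := by
        have : (a':ℝ)*b-a*b' = 1 := by exact_mod_cast hdet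
        rw [hδe]; linear_combination this
      have h2 : |(a:ℝ)*(a'*ξ-b')| ≤ 1 + a*|δ| := by
        rw [hd]
        calc _ ≤ |(1:ℝ)| + |a'*δ| := abs_add_le _ _
          _ = 1 + a'*|δ| := by rw [abs_one, abs_mul, abs_of_nonneg hm1R]
          _ ≤ _ := by gcongr
      rw [abs_mul, abs_of_pos hden] at h2
      have h3 : (a:ℝ)*|δ| ≤ 1 := by
        calc (a:ℝ)*|δ| ≤ T*|δ| := by gcongr
          _ ≤ 1 := hTδ
      rw [le_div_iff₀ hT0, le_div_iff₀ hz0]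
      calc |a'*ξ-b'| * T * z = a*|a'*ξ-b'| := by rw [haz]; ring
        _ ≤ 2 := by linarith
  · obtain ⟨z, hz⟩ : ∃ z : ℝ, z = T*|δ| := ⟨_, rfl⟩
    have hz0 : 0 < z := by rw [hz]; exact lt_of_lt_of_le (by positivity) hc
    have hδ0 : 0 < |δ| := by
      by_contra h; have := le_antisymm (not_lt.1 h) (abs_nonneg _)
      rw [hz, this] at hz0; simp at hz0
    have hδne : δ ≠ 0 := abs_pos.1 hδ0
    obtain ⟨k, hk⟩ : ∃ k : ℤ, k = -round ((u*ξ+v)/δ) := ⟨_, rfl⟩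
    obtain ⟨a', ha'⟩ : ∃ a', a' = u + k*a := ⟨_, rfl⟩
    obtain ⟨b', hb'⟩ : ∃ b', b' = -v + k*b := ⟨_, rfl⟩
    have hdet : a'*b-a*b' = 1 := by rw [ha', hb']; linear_combination huv
    have hdetR : (a':ℝ)*b-a*b' = 1 := by exact_mod_cast hdet
    have hd' : |a'*ξ-b'| ≤ |δ| := by
      have h1 := abs_sub_round ((u*ξ+v)/δ)
      have e : a'*ξ-b' = ((u*ξ+v)/δ - round ((u*ξ+v)/δ)) * δ := by
        rw [ha', hb', hk]; push_cast
        rw [sub_mul, div_mul_cancel₀ _ hδne]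
        rw [hδe]; ring
      rw [e, abs_mul]
      nlinarith
    refine ⟨a, b, a', b', z, hz0, by rw [hz]; exact hTδ, hdet, ?_, ?_, ?_, ?_⟩
    · rw [abs_of_pos hden, hz]
      rw [div_le_iff₀ hT0] at hc; linarith
    · rw [← hδe, le_div_iff₀ hT0, hz]; linarith
    · have e : (a':ℝ)*δ = a*(a'*ξ-b') - 1 := by rw [hδe]; linear_combination -hdetR
      have h2 : |(a':ℝ)| *|δ| ≤ 2 := by
        rw [← abs_mul, e]
        calc _ ≤ |(a:ℝ)*(a'*ξ-b')| + |(1:ℝ)| := abs_sub _ _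
          _ = a*|a'*ξ-b'| + 1 := by rw [abs_mul, abs_of_pos hden, abs_one]
          _ ≤ T*|δ| + 1 := by gcongr
          _ ≤ 2 := by linarith
      rw [← mul_div_assoc, le_div_iff₀ hz0, hz]
      nlinarith
    · have : z ≤ 1 := by rw [hz]; exact hTδ
      have h1 : 1 ≤ 2/z := by rw [le_div_iff₀ hz0]; linarith
      calc _ ≤ |δ| := hd'
        _ ≤ 1/T := hδ
        _ ≤ _ := by gcongr

theorem tri_bound (c0 c2 c3 m u1 u2 u3 v1 v2 v3 w1 w2 w3 : ℝ)
    (h0 : |c0| ≤ 2*m) (h2 : |c2| ≤ m) (h3 : |c3| ≤ 5*m)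
    (a1 : |u1| ≤ w1) (a2 : |u2| ≤ w2) (a3 : |u3| ≤ w3)
    (b1 : |v1| ≤ w1) (b2 : |v2| ≤ w2) (b3 : |v3| ≤ w3) :
    |c0*(u1*u2*u3) + c2*(u1*v2*v3+v1*u2*v3+v1*v2*u3) + c3*(v1*v2*v3)| ≤ 10*m*(w1*w2*w3) := by
  have hm : 0 ≤ m := (abs_nonneg _).trans h2
  have hw1 : 0 ≤ w1 := (abs_nonneg _).trans a1
  have hw2 : 0 ≤ w2 := (abs_nonneg _).trans a2
  have hw3 : 0 ≤ w3 := (abs_nonneg _).trans a3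
  have key : ∀ x1 x2 x3 : ℝ, |x1| ≤ w1 → |x2| ≤ w2 → |x3| ≤ w3 → |x1*x2*x3| ≤ w1*w2*w3 := by
    intro x1 x2 x3 h1 h2 h3
    rw [abs_mul, abs_mul]; gcongr
  have W : 0 ≤ w1*w2*w3 := by positivity
  have s1 : |c0*(u1*u2*u3)| ≤ 2*m*(w1*w2*w3) := by
    rw [abs_mul]; gcongr; exact key _ _ _ a1 a2 a3
  have s2 : |c2*(u1*v2*v3+v1*u2*v3+v1*v2*u3)| ≤ m*(3*(w1*w2*w3)) := by
    rw [abs_mul]; gcongr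
    have t1 := key _ _ _ a1 b2 b3
    have t2 := key _ _ _ b1 a2 b3
    have t3 := key _ _ _ b1 b2 a3
    have := abs_add_le (u1*v2*v3+v1*u2*v3) (v1*v2*u3)
    have := abs_add_le (u1*v2*v3) (v1*u2*v3)
    linarith
  have s3 : |c3*(v1*v2*v3)| ≤ 5*m*(w1*w2*w3) := by
    rw [abs_mul]; gcongr; exact key _ _ _ b1 b2 b3
  have := abs_add_le (c0*(u1*u2*u3) + c2*(u1*v2*v3+v1*u2*v3+v1*v2*u3)) (c3*(v1*v2*v3))
  have := abs_add_le (c0*(u1*u2*u3)) (c2*(u1*v2*v3+v1*u2*v3+v1*v2*u3))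
  linarith

theorem exists_shift (x f : ℤ) (hf : f ≠ 0) : ∃ k : ℤ, |x + 2*k*f| ≤ |f| := by
  have h1 := Int.emod_nonneg (x+|f|) (b := 2*f) (by omega)
  have h2 := Int.emod_lt_abs (x+|f|) (b := 2*f) (by omega)
  have h3 := Int.emod_add_mul_ediv (x+|f|) (2*f)
  refine ⟨-((x+|f|)/(2*f)), ?_⟩
  have e : x + 2*(-((x+|f|)/(2*f)))*f = (x+|f|) % (2*f) - |f| := by linear_combination -h3
  rw [e, abs_le]
  have : |2*f| = 2*|f| := by rw [abs_mul]; norm_num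
  rw [this] at h2
  constructor <;> linarith

/-- representation of the integer point `p` through the form `F` and a unimodular matrix -/
def CubRep (p0 p1 p2 p3 F0 F1 F2 F3 a b a' b' : ℤ) : Prop :=
  a'*b-a*b' = 1 ∧
  p0 = -a'^3*F0 + 3*a*a'^2*F1 - 3*a^2*a'*F2 + a^3*F3 ∧
  p1 = -b'*a'^2*F0 + (b*a'^2+2*a*a'*b')*F1 + (-2*a*a'*b-a^2*b')*F2 + a^2*b*F3 ∧
  p2 = -a'*b'^2*F0 + (a*b'^2+2*b*b'*a')*F1 + (-2*b*b'*a-b^2*a')*F2 + b^2*a*F3 ∧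
  p3 = -b'^3*F0 + 3*b*b'^2*F1 - 3*b^2*b'*F2 + b^3*F3

theorem rep_exists (p0 p1 p2 p3 a b a' b' : ℤ) (h : a'*b-a*b' = 1) :
    CubRep p0 p1 p2 p3 (a^3*p3-3*a^2*b*p2+3*a*b^2*p1-b^3*p0)
     (a^2*a'*p3-(a^2*b'+2*a*b*a')*p2+(b^2*a'+2*a*b*b')*p1-b^2*b'*p0)
     (a'^2*a*p3-(a'^2*b+2*a'*b'*a)*p2+(b'^2*a+2*a'*b'*b)*p1-b'^2*b*p0)
     (a'^3*p3-3*a'^2*b'*p2+3*a'*b'^2*p1-b'^3*p0) a b a' b' := by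
  have h3 : (a'*b-a*b')^3 = 1 := by rw [h]; norm_num
  refine ⟨h, ?_, ?_, ?_, ?_⟩
  · linear_combination (-p0)*h3
  · linear_combination (-p1)*h3
  · linear_combination (-p2)*h3
  · linear_combination (-p3)*h3

theorem rep_shift (p0 p1 p2 p3 F1 F2 F3 a b a' b' k : ℤ) (h : CubRep p0 p1 p2 p3 0 F1 F2 F3 a b a' b') :
    CubRep p0 p1 p2 p3 0 F1 (F2+2*k*F1) (F3+3*k*F2+3*k^2*F1) a b (a'+k*a) (b'+k*b) := by
  obtain ⟨h, h0, h1, h2, h3⟩ := h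
  refine ⟨by linear_combination h, ?_, ?_, ?_, ?_⟩
  · linear_combination h0
  · linear_combination h1
  · linear_combination h2
  · linear_combination h3

theorem rep_disc {p0 p1 p2 p3 F0 F1 F2 F3 a b a' b' : ℤ} (h : CubRep p0 p1 p2 p3 F0 F1 F2 F3 a b a' b') :
    (p0*p3-p1*p2)^2 - 4*(p0*p2-p1^2)*(p1*p3-p2^2) = (F0*F3-F1*F2)^2 - 4*(F0*F2-F1^2)*(F1*F3-F2^2) := by
  obtain ⟨h, rfl, rfl, rfl, rfl⟩ := h
  have h6 : (a'*b-a*b')^6 = 1 := by rw [h]; norm_num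
  linear_combination ((F0*F3-F1*F2)^2 - 4*(F0*F2-F1^2)*(F1*F3-F2^2))*h6

theorem rep_A {p0 p1 p2 p3 F0 F1 F2 F3 a b a' b' : ℤ} (h : CubRep p0 p1 p2 p3 F0 F1 F2 F3 a b a' b') :
    (F0*F2-F1^2)*(-a')^2+(F0*F3-F1*F2)*(-a')*a+(F1*F3-F2^2)*a^2 = p0*p2-p1^2 := by
  obtain ⟨h, rfl, rfl, rfl, rfl⟩ := h
  have h2 : (a'*b-a*b')^2 = 1 := by rw [h]; norm_num
  linear_combination (-((F0*F2-F1^2)*(-a')^2+(F0*F3-F1*F2)*(-a')*a+(F1*F3-F2^2)*a^2))*h2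

theorem rep_J {p0 p1 p2 p3 F0 F1 F2 F3 a b a' b' : ℤ} (h : CubRep p0 p1 p2 p3 F0 F1 F2 F3 a b a' b') :
    ((F0*F3-F1*F2)*F0-2*(F0*F2-F1^2)*F1)*(-a')^3+3*((F0*F3-F1*F2)*F1-2*(F0*F2-F1^2)*F2)*(-a')^2*a
    +3*((F0*F3-F1*F2)*F2-2*(F0*F2-F1^2)*F3)*(-a')*a^2+(2*(F1*F3-F2^2)*F2-(F0*F3-F1*F2)*F3)*a^3
    = -(p0^2*p3-3*p0*p1*p2+2*p1^3) := by
  obtain ⟨h, rfl, rfl, rfl, rfl⟩ := h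
  have h3 : (a'*b-a*b')^3 = 1 := by rw [h]; norm_num
  linear_combination (-(((F0*F3-F1*F2)*F0-2*(F0*F2-F1^2)*F1)*(-a')^3+3*((F0*F3-F1*F2)*F1-2*(F0*F2-F1^2)*F2)*(-a')^2*a
    +3*((F0*F3-F1*F2)*F2-2*(F0*F2-F1^2)*F3)*(-a')*a^2+(2*(F1*F3-F2^2)*F2-(F0*F3-F1*F2)*F3)*a^3))*h3

theorem F_bound (p0 p1 p2 p3 T m a b a' b' z : ℝ) (hp : 0 < p0) (hT : 0 < T)
    (h0 : |p0/T^3| ≤ 2*m) (h2 : |T*(p0*p2-p1^2)/p0| ≤ m)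
    (h3 : |T^3*(p0^2*p3-3*p0*p1*p2+2*p1^3)/p0^2| ≤ 5*m)
    (A1 : |a| ≤ T*z) (A2 : |a*(p1/p0)-b| ≤ z/T) (A3 : |a'| ≤ T*(2/z)) (A4 : |a'*(p1/p0)-b'| ≤ (2/z)/T) :
    |a^3*p3-3*a^2*b*p2+3*a*b^2*p1-b^3*p0| ≤ 10*m*(z*z*z) ∧
    |a^2*a'*p3-(a^2*b'+2*a*b*a')*p2+(b^2*a'+2*a*b*b')*p1-b^2*b'*p0| ≤ 10*m*(z*z*(2/z)) ∧
    |a'^2*a*p3-(a'^2*b+2*a'*b'*a)*p2+(b'^2*a+2*a'*b'*b)*p1-b'^2*b*p0| ≤ 10*m*((2/z)*(2/z)*z) ∧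
    |a'^3*p3-3*a'^2*b'*p2+3*a'*b'^2*p1-b'^3*p0| ≤ 10*m*((2/z)*(2/z)*(2/z)) := by
  have B1 : |a/T| ≤ z := by
    rw [abs_div, abs_of_pos hT, div_le_iff₀ hT]; linarith
  have B3 : |a'/T| ≤ 2/z := by
    rw [abs_div, abs_of_pos hT, div_le_iff₀ hT]; linarith
  have B2 : |T*(a*(p1/p0)-b)| ≤ z := by
    rw [abs_mul, abs_of_pos hT]; rw [le_div_iff₀ hT] at A2; linarith
  have B4 : |T*(a'*(p1/p0)-b')| ≤ 2/z := by
    rw [abs_mul, abs_of_pos hT]; rw [le_div_iff₀ hT] at A4; linarith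
  have hT' := hT.ne'
  have hp' := hp.ne'
  refine ⟨?_, ?_, ?_, ?_⟩
  · convert tri_bound _ _ _ m _ _ _ _ _ _ z z z h0 h2 h3 B2 B2 B2 B1 B1 B1 using 2
    field_simp; ring
  · convert tri_bound _ _ _ m _ _ _ _ _ _ z z (2/z) h0 h2 h3 B2 B2 B4 B1 B1 B3 using 2
    field_simp; ring
  · convert tri_bound _ _ _ m _ _ _ _ _ _ (2/z) (2/z) z h0 h2 h3 B4 B4 B2 B3 B3 B1 using 2
    field_simp; ring
  · convert tri_bound _ _ _ m _ _ _ _ _ _ (2/z) (2/z) (2/z) h0 h2 h3 B4 B4 B4 B3 B3 B3 using 2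
    field_simp; ring

theorem exists_cuberoot (x : ℝ) (hx : 1 ≤ x) : ∃ T : ℝ, 1 ≤ T ∧ T^3 = x := by
  refine ⟨x^((1:ℝ)/3), Real.one_le_rpow hx (by norm_num), ?_⟩
  rw [← Real.rpow_natCast, ← Real.rpow_mul (by linarith)]; norm_num

theorem red1 (p0 p1 p2 p3 : ℤ) (Q H m : ℝ) (hm : 1 ≤ m) (hmQ : m ≤ Q) (hq1 : Q ≤ p0) (hq2 : p0 ≤ 2*Q)
    (hA : |(p0:ℝ)*p2-p1^2| ≤ H) (hH : H^3 ≤ Q^2)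
    (hD : (((p0:ℝ)*p3-p1*p2)^2 - 4*(p0*p2-p1^2)*(p1*p3-p2^2)) ≤ 16*m^4) :
    ∃ (F0 F1 F2 F3 a b a' b' : ℤ) (z : ℝ), 0 < z ∧ z ≤ 1 ∧ CubRep p0 p1 p2 p3 F0 F1 F2 F3 a b a' b' ∧
     |(F0:ℝ)| ≤ 10*m*(z*z*z) ∧ |(F1:ℝ)| ≤ 10*m*(z*z*(2/z)) ∧ |(F2:ℝ)| ≤ 10*m*((2/z)*(2/z)*z) ∧
     |(F3:ℝ)| ≤ 10*m*((2/z)*(2/z)*(2/z)) := by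
  have hm0 : 0 < m := by linarith
  have hQ0 : 0 < Q := by linarith
  have hp : 0 < (p0:ℝ) := by linarith
  obtain ⟨T, hT1, hT3⟩ := exists_cuberoot (Q/m) (by rw [le_div_iff₀ hm0]; linarith)
  have hT0 : 0 < T := by linarith
  obtain ⟨a, b, a', b', z, hz0, hz1, hdet, A1, A2, A3, A4⟩ := geom_red (p1/p0) T hT1
  have hH0 : 0 ≤ H := (abs_nonneg _).trans hA
  have hm4 : 1 ≤ m^4 := one_le_pow₀ hm
  have h0 : |(p0:ℝ)/T^3| ≤ 2*m := by
    rw [hT3, abs_of_pos (by positivity), div_le_iff₀ (by positivity)]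
    calc (p0:ℝ) ≤ 2*Q := hq2
      _ = _ := by field_simp
  have hTH : T*H ≤ Q*m := by
    refine le_of_pow_le_pow_left₀ (n := 3) (by norm_num) (by positivity) ?_
    rw [mul_pow, hT3, mul_pow]
    calc Q/m*H^3 ≤ Q/m*Q^2 := by gcongr
      _ = Q^3/m := by ring
      _ ≤ Q^3*m^3 := by
        rw [div_le_iff₀ hm0]
        calc Q^3 = Q^3*1 := by ring
          _ ≤ Q^3*m^4 := by gcongr
          _ = _ := by ring
  have h2 : |T*((p0:ℝ)*p2-p1^2)/p0| ≤ m := by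
    rw [abs_div, abs_mul, abs_of_pos hT0, abs_of_pos hp, div_le_iff₀ hp]
    calc T*|(p0:ℝ)*p2-p1^2| ≤ T*H := by gcongr
      _ ≤ Q*m := hTH
      _ ≤ m*p0 := by rw [mul_comm]; gcongr
  have hJ : |(p0:ℝ)^2*p3-3*p0*p1*p2+2*p1^3| ≤ 5*p0*m^2 := by
    apply abs_le_of_sq_le_sq _ (by positivity)
    have syz : ((p0:ℝ)^2*p3-3*p0*p1*p2+2*p1^3)^2 = p0^2*(((p0:ℝ)*p3-p1*p2)^2 - 4*(p0*p2-p1^2)*(p1*p3-p2^2))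
      - 4*(p0*p2-p1^2)^3 := by ring
    rw [syz]
    have c1 : -(H^3) ≤ ((p0:ℝ)*p2-p1^2)^3 := by
      have : (-H)^3 ≤ ((p0:ℝ)*p2-p1^2)^3 :=
        (Odd.strictMono_pow (R := ℝ) (n := 3) (by decide)).monotone (abs_le.1 hA).1
      calc -(H^3) = (-H)^3 := by ring
        _ ≤ _ := this
    have c2 : (p0:ℝ)^2*(((p0:ℝ)*p3-p1*p2)^2 - 4*(p0*p2-p1^2)*(p1*p3-p2^2)) ≤ p0^2*(16*m^4) := by gcongr
    have c3 : Q^2 ≤ (p0:ℝ)^2 := by gcongr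
    have c4 : (p0:ℝ)^2*1 ≤ p0^2*m^4 := by gcongr
    calc _ ≤ p0^2*(16*m^4) + 4*H^3 := by linarith
      _ ≤ p0^2*(16*m^4) + 4*(p0^2*m^4) := by linarith
      _ ≤ (5*p0*m^2)^2 := by
        have : 0 ≤ (p0:ℝ)^2*m^4 := by positivity
        nlinarith
  have h3 : |T^3*((p0:ℝ)^2*p3-3*p0*p1*p2+2*p1^3)/p0^2| ≤ 5*m := by
    rw [abs_div, abs_mul, hT3, abs_of_pos (by positivity : 0 < Q/m), abs_of_pos (by positivity : 0 < (p0:ℝ)^2),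
      div_le_iff₀ (by positivity)]
    calc Q/m*|(p0:ℝ)^2*p3-3*p0*p1*p2+2*p1^3| ≤ p0/m*(5*p0*m^2) := by gcongr
      _ = 5*m*p0^2 := by field_simp
  have key := F_bound p0 p1 p2 p3 T m a b a' b' z hp hT0 h0 h2 h3 A1 A2 A3 A4
  refine ⟨_, _, _, _, a, b, a', b', z, hz0, hz1, rep_exists p0 p1 p2 p3 a b a' b' hdet, ?_⟩
  push_cast
  exact key

noncomputable def fSet (M : ℕ) : Finset (ℤ × ℤ × ℤ × ℤ) :=
  ((gSet (M^2) ×ˢ gSet (M^2)).image fun u => (u.1.1, u.2.1, u.2.2, u.1.2)) ∪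
  ((zSet M).image fun u => (0, u.1, u.2.1, u.2.2))

theorem fSet_card (M : ℕ) : ((fSet M).card : ℝ) ≤
    (1 + 4 * (M^2 : ℕ) * hSum (M^2) + 4 * (M^2 : ℕ))^2 + (24 * M^4 * hSum M + 6 * M * M) := by
  have h1 : (fSet M).card ≤ (gSet (M^2)).card * (gSet (M^2)).card + (zSet M).card := by
    refine (Finset.card_union_le _ _).trans ?_
    gcongr
    · refine Finset.card_image_le.trans ?_
      rw [Finset.card_product]
    · exact Finset.card_image_le
  have h2 := gSet_card (M^2)
  have h3 := zSet_card M
  calc ((fSet M).card : ℝ) ≤ ((gSet (M^2)).card:ℝ) * ((gSet (M^2)).card:ℝ) + ((zSet M).card:ℝ) := by exact_mod_cast h1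
    _ ≤ _ := by
      rw [sq (1 + 4 * ((M^2 : ℕ):ℝ) * hSum (M^2) + 4 * ((M^2 : ℕ):ℝ))]
      exact add_le_add (mul_le_mul h2 h2 (by positivity) ((Nat.cast_nonneg _).trans h2)) h3

theorem gmem (x y : ℤ) (N : ℕ) (hx : |(x:ℝ)| ≤ N) (hy : |(y:ℝ)| ≤ N) (hxy : |(x:ℝ)| * |(y:ℝ)| ≤ N) : (x,y) ∈ gSet N := by
  simp only [gSet, Finset.mem_filter, Finset.mem_product, Finset.mem_Icc]
  rw [← abs_mul] at hxy
  have h1 : |x| ≤ (N:ℤ) := by exact_mod_cast hx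
  have h2 : |y| ≤ (N:ℤ) := by exact_mod_cast hy
  exact ⟨⟨abs_le.1 h1, abs_le.1 h2⟩, by exact_mod_cast hxy⟩

theorem case_g (F0 F1 F2 F3 z m : ℝ) (hm : 1 ≤ m) (hz : 0 < z) (hz1 : z ≤ 1) (hF : 1 ≤ |F0|)
    (h0 : |F0| ≤ 10*m*(z*z*z)) (h1 : |F1| ≤ 10*m*(z*z*(2/z))) (h2 : |F2| ≤ 10*m*((2/z)*(2/z)*z))
    (h3 : |F3| ≤ 10*m*((2/z)*(2/z)*(2/z))) :
    |F0| ≤ (80*m)^2 ∧ |F3| ≤ (80*m)^2 ∧ |F0| * |F3| ≤ (80*m)^2 ∧ |F1| ≤ (80*m)^2 ∧ |F2| ≤ (80*m)^2 ∧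
      |F1| * |F2| ≤ (80*m)^2 := by
  have e1 : 10*m*(z*z*(2/z)) = 20*m*z := by field_simp; ring
  have e2 : 10*m*((2/z)*(2/z)*z) = 40*m/z := by field_simp; ring
  have e3 : 10*m*((2/z)*(2/z)*(2/z)) = 80*m/z^3 := by field_simp; ring
  rw [e1] at h1; rw [e2] at h2; rw [e3] at h3
  have hm0 : 0 < m := by linarith
  have e0 : 10*m*(z*z*z) = 10*m*z^3 := by ring
  rw [e0] at h0
  have hz3 : z^3 ≤ 1 := pow_le_one₀ hz.le hz1
  have hz3' : z^3 ≤ z := by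
    calc z^3 = z*z^2 := by ring
      _ ≤ z*1 := by gcongr; exact pow_le_one₀ hz.le hz1
      _ = z := by ring
  have hzi : 1/z^3 ≤ 10*m := by
    rw [div_le_iff₀ (by positivity)]; linarith
  have hzi' : 1/z ≤ 10*m := (one_div_le_one_div_of_le (by positivity) hz3').trans hzi
  have mm : m ≤ m^2 := by nlinarith
  have b0 : |F0| ≤ 10*m := h0.trans (by nlinarith)
  have b1 : |F1| ≤ 20*m := h1.trans (by nlinarith)
  have b2 : |F2| ≤ 400*m^2 := by
    calc |F2| ≤ 40*m*(1/z) := by rw [mul_one_div]; exact h2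
      _ ≤ 40*m*(10*m) := by gcongr
      _ = _ := by ring
  have b3 : |F3| ≤ 800*m^2 := by
    calc |F3| ≤ 80*m*(1/z^3) := by rw [mul_one_div]; exact h3
      _ ≤ 80*m*(10*m) := by gcongr
      _ = _ := by ring
  have p1 : |F0| * |F3| ≤ 800*m^2 := by
    calc _ ≤ (10*m*z^3)*(80*m/z^3) := by gcongr
      _ = _ := by field_simp; ring
  have p2 : |F1| * |F2| ≤ 800*m^2 := by
    calc _ ≤ (20*m*z)*(40*m/z) := by gcongr
      _ = _ := by field_simp; ring
  refine ⟨?_, ?_, ?_, ?_, ?_, ?_⟩ <;> nlinarith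

theorem red2 (p0 p1 p2 p3 : ℤ) (Q H : ℝ) (m : ℕ) (hm : 1 ≤ m) (hmQ : m ≤ Q) (hq1 : Q ≤ p0) (hq2 : p0 ≤ 2*Q)
    (hA : |(p0:ℝ)*p2-p1^2| ≤ H) (hH : H^3 ≤ Q^2)
    (hD0 : 1 ≤ ((p0*p3-p1*p2)^2 - 4*(p0*p2-p1^2)*(p1*p3-p2^2)))
    (hD : ((p0*p3-p1*p2)^2 - 4*(p0*p2-p1^2)*(p1*p3-p2^2)) ≤ 16*(m:ℤ)^4) :
    ∃ (F0 F1 F2 F3 a b a' b' : ℤ), (F0,F1,F2,F3) ∈ fSet (80*m) ∧ CubRep p0 p1 p2 p3 F0 F1 F2 F3 a b a' b' := by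
  have hmR : (1:ℝ) ≤ m := by exact_mod_cast hm
  obtain ⟨F0, F1, F2, F3, a, b, a', b', z, hz0, hz1, rep, h0, h1, h2, h3⟩ :=
    red1 p0 p1 p2 p3 Q H m hmR hmQ hq1 hq2 hA hH (by exact_mod_cast hD)
  by_cases hF : F0 = 0
  · subst hF
    have rd := rep_disc rep
    have hF1 : F1 ≠ 0 := by
      rintro rfl
      rw [rd] at hD0; norm_num at hD0
    obtain ⟨k, hk⟩ := exists_shift F2 F1 hF1
    have rep2 := rep_shift _ _ _ _ _ _ _ _ _ _ _ k rep
    refine ⟨_, _, _, _, _, _, _, _, ?_, rep2⟩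
    have rd2 := rep_disc rep2
    have e1 : 10*(m:ℝ)*(z*z*(2/z)) = 20*m*z := by field_simp; ring
    rw [e1] at h1
    generalize F2+2*k*F1 = G2 at *
    generalize F3+3*k*F2+3*k^2*F1 = G3 at *
    clear rd
    rw [rd2] at hD0 hD
    have hF1M : |F1| ≤ 80*(m:ℤ) := by
      have : |(F1:ℝ)| ≤ 80*m := h1.trans (by nlinarith)
      exact_mod_cast this
    have hF1p : 1 ≤ |F1| := Int.one_le_abs hF1
    have hk2 : F1^2*G2^2 ≤ (80*(m:ℤ))^4 := by
      have t1 : |F1|^2*|G2|^2 ≤ (80*(m:ℤ))^2*(80*(m:ℤ))^2 := by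
        gcongr; exact hk.trans hF1M
      rw [sq_abs, sq_abs] at t1
      linarith
    have hk0 : 0 ≤ F1^2*G2^2 := by positivity
    have eD : (0*G3-F1*G2)^2 - 4*(0*G2-F1^2)*(F1*G3-G2^2) = 4*(F1^3*G3) - 3*(F1^2*G2^2) := by ring
    rw [eD] at hD hD0
    have m4 : 0 ≤ (m:ℤ)^4 := by positivity
    have e80 : (80*(m:ℤ))^4 = 40960000*(m:ℤ)^4 := by ring
    have hG3 : |G3| * |F1|^3 ≤ 2*(80*(m:ℤ))^4 := by
      rw [← abs_pow, ← abs_mul, mul_comm G3, abs_le]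
      constructor <;> linarith
    have hG3' : |G3| ≤ 2*(80*(m:ℤ))^4 := by
      calc |G3| = |G3| * 1 := by ring
        _ ≤ |G3| * |F1|^3 := by gcongr; exact one_le_pow₀ hF1p
        _ ≤ _ := hG3
    unfold fSet
    apply Finset.mem_union_right
    rw [Finset.mem_image]
    refine ⟨(F1, G2, G3), ?_, rfl⟩
    simp only [zSet, Finset.mem_filter, Finset.mem_product, Finset.mem_Icc]
    push_cast
    exact ⟨⟨abs_le.1 hF1M, abs_le.1 (hk.trans hF1M), abs_le.1 hG3'⟩, hF1, hk, hG3⟩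
  · refine ⟨F0, F1, F2, F3, a, b, a', b', ?_, rep⟩
    have hF1 : (1:ℝ) ≤ |(F0:ℝ)| := by exact_mod_cast Int.one_le_abs hF
    obtain ⟨g1, g2, g3, g4, g5, g6⟩ := case_g F0 F1 F2 F3 z m hmR hz0 hz1 hF1 h0 h1 h2 h3
    unfold fSet
    apply Finset.mem_union_left
    rw [Finset.mem_image]
    refine ⟨((F0,F3),(F1,F2)), ?_, rfl⟩
    rw [Finset.mem_product]
    constructor <;> apply gmem <;> push_cast <;> assumption

abbrev P4 := ℤ × ℤ × ℤ × ℤ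

theorem fib_shift (R : ℕ) (S : Finset P4) (F0 F1 F2 F3 a a' : ℤ) (b b' : P4 → ℤ)
    (hrep : ∀ p ∈ S, CubRep p.1 p.2.1 p.2.2.1 p.2.2.2 F0 F1 F2 F3 a (b p) a' (b' p))
    (hpos : ∀ p ∈ S, 0 < p.1) (hR : ∀ p ∈ S, |p.2.1| ≤ R * p.1) : S.card ≤ 4*R+1 := by
  rcases S.eq_empty_or_nonempty with he | ⟨w, hw⟩
  · rw [he]; simp
  have hd := (hrep w hw).1
  have hb : ∀ p ∈ S, b p = b w + (-(b' w)*(b p - b w)+ b w*(b' p - b' w))*a ∧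
      b' p = b' w + (-(b' w)*(b p - b w)+ b w*(b' p - b' w))*a' := by
    intro p hp
    have hd2 := (hrep p hp).1
    constructor
    · linear_combination (-(b p))*hd + (b w)*hd2
    · linear_combination (-(b' p))*hd + (b' w)*hd2
  set κ : P4 → ℤ := fun p => (-(b' w)*(b p - b w)+ b w*(b' p - b' w)) with hκ
  have hk : ∀ p ∈ S, |κ p| ≤ (2*R : ℕ) := by
    intro p hp
    obtain ⟨e1, e2⟩ := hb p hp
    have h0 : p.1 = w.1 := by rw [(hrep p hp).2.1, (hrep w hw).2.1]
    have h1 : p.2.1 = w.2.1 + κ p * w.1 := by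
      rw [(hrep p hp).2.2.1, (hrep w hw).2.2.1, (hrep w hw).2.1]
      have : b p = b w + κ p * a := e1
      rw [this]
      have : b' p = b' w + κ p * a' := e2
      rw [this]; ring
    have t1 := hR p hp
    have t2 := hR w hw
    have t3 := hpos w hw
    rw [h0] at t1
    have : |κ p * w.1| ≤ 2*R*w.1 := by
      have : κ p * w.1 = p.2.1 - w.2.1 := by linarith
      rw [this]
      have := abs_sub p.2.1 w.2.1
      linarith
    rw [abs_mul, abs_of_pos t3] at this
    push_cast
    exact le_of_mul_le_mul_right this t3
  have hinj : Set.InjOn κ S := by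
    intro p hp p' hp' he
    obtain ⟨e1, e2⟩ := hb p hp
    obtain ⟨e1', e2'⟩ := hb p' hp'
    have e1 : b p = b w + κ p * a := e1
    have e2 : b' p = b' w + κ p * a' := e2
    have e1' : b p' = b w + κ p' * a := e1'
    have e2' : b' p' = b' w + κ p' * a' := e2'
    have E1 : b p = b p' := by rw [e1, e1', he]
    have E2 : b' p = b' p' := by rw [e2, e2', he]
    obtain ⟨_, r0, r1, r2, r3⟩ := hrep p hp
    obtain ⟨_, s0, s1, s2, s3⟩ := hrep p' hp'
    rw [E1, E2] at r1 r2 r3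
    ext
    · rw [r0, s0]
    · rw [r1, s1]
    · rw [r2, s2]
    · rw [r3, s3]
  have := card_Icc_le (S.image κ) (2*R) (by
    intro j hj
    rw [Finset.mem_image] at hj
    obtain ⟨p, hp, rfl⟩ := hj
    exact hk p hp)
  rw [Finset.card_image_of_injOn hinj] at this
  omega

theorem fib_F (R N : ℕ) (S : Finset P4) (F0 F1 F2 F3 : ℤ) (a b a' b' : P4 → ℤ) (Q H s M : ℝ)
    (hrep : ∀ p ∈ S, CubRep p.1 p.2.1 p.2.2.1 p.2.2.2 F0 F1 F2 F3 (a p) (b p) (a' p) (b' p))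
    (hR : ∀ p ∈ S, |p.2.1| ≤ R * p.1) (hQ : 0 < Q) (hHQ : 4*H^3 ≤ Q^2)
    (hq1 : ∀ p ∈ S, Q ≤ p.1) (hq2 : ∀ p ∈ S, (p.1:ℝ) ≤ 2*Q)
    (hA : ∀ p ∈ S, |(p.1:ℝ)*p.2.2.1-p.2.1^2| ≤ H)
    (hs : s^2 = ((F0:ℝ)*F3-F1*F2)^2 - 4*(F0*F2-F1^2)*(F1*F3-F2^2)) (hM : 1 ≤ M) (hs1 : M ≤ |s|)
    (hj : ∀ p ∈ S, 0 ≤ s * (-((p.1:ℝ)^2*p.2.2.2-3*p.1*p.2.1*p.2.2.1+2*p.2.1^3)))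
    (hN : ∀ j : ℤ, |(j:ℝ)| * M ≤ 4*H → |j| ≤ N) :
    S.card ≤ (4*R+1) * ⌊2 + 4 * (N:ℝ) * hSum N + 2 * N⌋₊ := by
  have hpos : ∀ p ∈ S, 0 < p.1 := fun p hp => by
    have := hq1 p hp
    have : (0:ℝ) < p.1 := by linarith
    exact_mod_cast this
  set V : Finset (ℤ × ℤ) := S.image (fun p => (-(a' p), a p)) with hV
  have h1 : S.card ≤ (4*R+1) * V.card := by
    apply Finset.card_le_mul_card_image
    intro v hv
    apply fib_shift R _ F0 F1 F2 F3 v.2 (-v.1) b b'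
    · intro p hp
      rw [Finset.mem_filter] at hp
      rw [← hp.2]
      simpa using hrep p hp.1
    · intro p hp; exact hpos p (Finset.mem_filter.1 hp).1
    · intro p hp; exact hR p (Finset.mem_filter.1 hp).1
  refine h1.trans (Nat.mul_le_mul_left _ ?_)
  apply Nat.le_floor
  apply vec_count V N
  · intro v hv
    rw [hV, Finset.mem_image] at hv
    obtain ⟨p, hp, rfl⟩ := hv
    exact ⟨-(b p), -(b' p), by have := (hrep p hp).1; simp only; linear_combination this⟩
  · intro v hv w hw
    rw [hV, Finset.mem_image] at hv hw
    obtain ⟨p, hp, rfl⟩ := hv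
    obtain ⟨p', hp', rfl⟩ := hw
    apply hN
    have hs2 : 1 ≤ s^2 := by
      rw [← sq_abs]; exact one_le_pow₀ (hM.trans hs1)
    have E : ∀ p ∈ S, (F0:ℝ)*(-(a' p))^3+3*F1*(-(a' p))^2*(a p)+3*F2*(-(a' p))*(a p)^2+F3*(a p)^3 = p.1 := by
      intro p hp
      have := (hrep p hp).2.1
      rw [this]; push_cast; ring
    have G : ∀ p ∈ S, |((F0:ℝ)*F2-F1^2)*(-(a' p))^2+(F0*F3-F1*F2)*(-(a' p))*(a p)+(F1*F3-F2^2)*(a p)^2| ≤ H := by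
      intro p hp
      have e := rep_A (hrep p hp)
      have e' : ((F0:ℝ)*F2-F1^2)*(-(a' p))^2+(F0*F3-F1*F2)*(-(a' p))*(a p)+(F1*F3-F2^2)*(a p)^2 =
        (p.1:ℝ)*p.2.2.1-p.2.1^2 := by exact_mod_cast e
      rw [e']; exact hA p hp
    have K : ∀ p ∈ S, 0 ≤ s * ((((F0:ℝ)*F3-F1*F2)*F0-2*(F0*F2-F1^2)*F1)*(-(a' p))^3+3*((F0*F3-F1*F2)*F1-2*(F0*F2-F1^2)*F2)*(-(a' p))^2*(a p)
    +3*((F0*F3-F1*F2)*F2-2*(F0*F2-F1^2)*F3)*(-(a' p))*(a p)^2+(2*(F1*F3-F2^2)*F2-(F0*F3-F1*F2)*F3)*(a p)^3) := by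
      intro p hp
      have e := rep_J (hrep p hp)
      have e' : (((F0:ℝ)*F3-F1*F2)*F0-2*(F0*F2-F1^2)*F1)*(-(a' p))^3+3*((F0*F3-F1*F2)*F1-2*(F0*F2-F1^2)*F2)*(-(a' p))^2*(a p)
    +3*((F0*F3-F1*F2)*F2-2*(F0*F2-F1^2)*F3)*(-(a' p))*(a p)^2+(2*(F1*F3-F2^2)*F2-(F0*F3-F1*F2)*F3)*(a p)^3 =
        (-((p.1:ℝ)^2*p.2.2.2-3*p.1*p.2.1*p.2.2.1+2*p.2.1^3)) := by exact_mod_cast e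
      rw [e']; exact hj p hp
    have key := two_point F0 F1 F2 F3 s (-(a' p)) (a p) (-(a' p')) (a p') Q H hs hs2 hQ hHQ
      (by rw [E p hp]; exact hq1 p hp) (by rw [E p hp]; exact hq2 p hp)
      (by rw [E p' hp']; exact hq1 p' hp') (by rw [E p' hp']; exact hq2 p' hp')
      (G p hp) (G p' hp') (K p hp) (K p' hp')
    push_cast
    refine le_trans ?_ key
    gcongr

theorem count_m (R N m : ℕ) (hm : 1 ≤ m) (S : Finset P4) (Q H : ℝ) (hmQ : m ≤ Q)
    (hR : ∀ p ∈ S, |p.2.1| ≤ R * p.1) (hHQ : 4*H^3 ≤ Q^2)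
    (hq1 : ∀ p ∈ S, Q ≤ p.1) (hq2 : ∀ p ∈ S, (p.1:ℝ) ≤ 2*Q)
    (hA : ∀ p ∈ S, |(p.1:ℝ)*p.2.2.1-p.2.1^2| ≤ H)
    (hD1 : ∀ p ∈ S, (m:ℤ)^4 ≤ (p.1*p.2.2.2-p.2.1*p.2.2.1)^2 - 4*(p.1*p.2.2.1-p.2.1^2)*(p.2.1*p.2.2.2-p.2.2.1^2))
    (hD2 : ∀ p ∈ S, (p.1*p.2.2.2-p.2.1*p.2.2.1)^2 - 4*(p.1*p.2.2.1-p.2.1^2)*(p.2.1*p.2.2.2-p.2.2.1^2) ≤ 16*(m:ℤ)^4)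
    (hN : ∀ j : ℤ, |(j:ℝ)| * (m:ℝ)^2 ≤ 4*H → |j| ≤ N) :
    S.card ≤ 2 * ((4*R+1) * ⌊2 + 4 * (N:ℝ) * hSum N + 2 * N⌋₊) * (fSet (80*m)).card := by
  have hmR : (1:ℝ) ≤ m := by exact_mod_cast hm
  have hQ : 0 < Q := by linarith
  have hm4 : 1 ≤ (m:ℤ)^4 := one_le_pow₀ (by exact_mod_cast hm)
  have ex : ∀ p : P4, ∃ (F0 F1 F2 F3 a b a' b' : ℤ), p ∈ S → ((F0,F1,F2,F3) ∈ fSet (80*m) ∧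
      CubRep p.1 p.2.1 p.2.2.1 p.2.2.2 F0 F1 F2 F3 a b a' b') := by
    intro p
    by_cases hp : p ∈ S
    · have hH3 : H^3 ≤ Q^2 := by nlinarith [sq_nonneg Q]
      obtain ⟨F0, F1, F2, F3, a, b, a', b', h⟩ := red2 p.1 p.2.1 p.2.2.1 p.2.2.2 Q H m hm hmQ (hq1 p hp) (hq2 p hp)
        (hA p hp) hH3 (hm4.trans (hD1 p hp)) (hD2 p hp)
      exact ⟨F0, F1, F2, F3, a, b, a', b', fun _ => h⟩
    · exact ⟨0,0,0,0,0,0,0,0, fun h => absurd h hp⟩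
  choose F0 F1 F2 F3 a b a' b' h using ex
  refine Finset.card_le_mul_card_image_of_maps_to (f := fun p => (F0 p, F1 p, F2 p, F3 p)) (fun p hp => (h p hp).1) _ ?_
  rintro ⟨G0, G1, G2, G3⟩ -
  set S' := S.filter (fun p => (F0 p, F1 p, F2 p, F3 p) = (G0, G1, G2, G3)) with hS'
  have hrep : ∀ p ∈ S', CubRep p.1 p.2.1 p.2.2.1 p.2.2.2 G0 G1 G2 G3 (a p) (b p) (a' p) (b' p) := by
    intro p hp
    rw [hS', Finset.mem_filter] at hp
    have h1 := (h p hp.1).2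
    have h2 := hp.2
    simp only [Prod.mk.injEq] at h2
    obtain ⟨e0, e1, e2, e3⟩ := h2
    rwa [e0, e1, e2, e3] at h1
  have hsub : ∀ p ∈ S', p ∈ S := fun p hp => (Finset.mem_filter.1 hp).1
  rcases S'.eq_empty_or_nonempty with he | ⟨w, hw⟩
  · rw [he]; simp
  have hDG : (m:ℝ)^4 ≤ ((G0:ℝ)*G3-G1*G2)^2 - 4*(G0*G2-G1^2)*(G1*G3-G2^2) := by
    have := hD1 w (hsub w hw)
    rw [rep_disc (hrep w hw)] at this
    exact_mod_cast this
  set s := Real.sqrt (((G0:ℝ)*G3-G1*G2)^2 - 4*(G0*G2-G1^2)*(G1*G3-G2^2)) with hs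
  have hs0 : 0 ≤ s := Real.sqrt_nonneg _
  have hsq : s^2 = ((G0:ℝ)*G3-G1*G2)^2 - 4*(G0*G2-G1^2)*(G1*G3-G2^2) :=
    Real.sq_sqrt (le_trans (by positivity) hDG)
  have hms : (m:ℝ)^2 ≤ |s| := by
    rw [abs_of_nonneg hs0]
    apply Real.le_sqrt_of_sq_le
    calc ((m:ℝ)^2)^2 = (m:ℝ)^4 := by ring
      _ ≤ _ := hDG
  have hm2 : (1:ℝ) ≤ (m:ℝ)^2 := one_le_pow₀ hmR
  have hsplit := Finset.card_filter_add_card_filter_not (s := S')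
    (fun p : P4 => (p.1:ℝ)^2*p.2.2.2-3*p.1*p.2.1*p.2.2.1+2*p.2.1^3 ≤ 0)
  have sub2 : ∀ (q : P4 → Prop) [DecidablePred q], ∀ p ∈ S'.filter q, p ∈ S' := fun q _ p hp => (Finset.mem_filter.1 hp).1
  have c1 := fib_F R N (S'.filter (fun p : P4 => (p.1:ℝ)^2*p.2.2.2-3*p.1*p.2.1*p.2.2.1+2*p.2.1^3 ≤ 0))
    G0 G1 G2 G3 a b a' b' Q H s ((m:ℝ)^2)
    (fun p hp => hrep p (sub2 _ p hp)) (fun p hp => hR p (hsub p (sub2 _ p hp))) hQ hHQ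
    (fun p hp => hq1 p (hsub p (sub2 _ p hp))) (fun p hp => hq2 p (hsub p (sub2 _ p hp)))
    (fun p hp => hA p (hsub p (sub2 _ p hp))) hsq hm2 hms
    (fun p hp => by
      have := (Finset.mem_filter.1 hp).2
      exact mul_nonneg hs0 (by linarith)) hN
  have c2 := fib_F R N (S'.filter (fun p : P4 => ¬ ((p.1:ℝ)^2*p.2.2.2-3*p.1*p.2.1*p.2.2.1+2*p.2.1^3 ≤ 0)))
    G0 G1 G2 G3 a b a' b' Q H (-s) ((m:ℝ)^2)
    (fun p hp => hrep p (sub2 _ p hp)) (fun p hp => hR p (hsub p (sub2 _ p hp))) hQ hHQ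
    (fun p hp => hq1 p (hsub p (sub2 _ p hp))) (fun p hp => hq2 p (hsub p (sub2 _ p hp)))
    (fun p hp => hA p (hsub p (sub2 _ p hp))) (by rw [neg_sq]; exact hsq) hm2 (by rw [abs_neg]; exact hms)
    (fun p hp => by
      have := (Finset.mem_filter.1 hp).2
      push Not at this
      rw [neg_mul_neg]
      exact mul_nonneg hs0 this.le) hN
  rw [← hsplit, two_mul]
  exact add_le_add c1 c2

theorem arith_m (M2 hs1 hs2 L c : ℝ) (hM : 1 ≤ M2) (hL : 1 ≤ L) (h10 : 0 ≤ hs1) (h1 : hs1 ≤ L) (h2 : hs2 ≤ L)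
    (hc : c ≤ (1 + 4 * M2 * hs1 + 4 * M2)^2 + (24 * M2^2 * hs2 + 6 * M2)) : c ≤ 111*M2^2*L^2 := by
  have e1 : 1 + 4 * M2 * hs1 + 4 * M2 ≤ 9*M2*L := by
    have : M2*hs1 ≤ M2*L := by gcongr
    have : M2*1 ≤ M2*L := by gcongr
    nlinarith
  have e2 : (1 + 4 * M2 * hs1 + 4 * M2)^2 ≤ (9*M2*L)^2 := by gcongr
  have e3 : M2^2*hs2 ≤ M2^2*L^2 := by
    gcongr; nlinarith
  have e4 : M2 ≤ M2^2*L^2 := by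
    have : 1 ≤ L^2 := one_le_pow₀ hL
    have : M2*1 ≤ M2*M2 := by gcongr
    have : M2^2*1 ≤ M2^2*L^2 := by gcongr
    nlinarith
  nlinarith

theorem arith_v (m H L Nr hs : ℝ) (hm : 1 ≤ m) (hH : 1 ≤ H) (hL : 1 ≤ L) (hmH : m^4 ≤ 5*H^2) (hN0 : 0 ≤ Nr)
    (hN : Nr ≤ 4*H/m^2) (hh : hs ≤ L) :
    (2 + 4 * Nr * hs + 2 * Nr) * m^4 ≤ 82*H^2*L := by
  have hm0 : 0 < m := by linarith
  have m2 : m^2 ≤ 3*H := by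
    apply le_of_sq_le_sq _ (by positivity)
    nlinarith
  have a1 : 2 + 4*Nr*hs+2*Nr ≤ 2 + 6*(Nr*L) := by
    have : Nr*hs ≤ Nr*L := by gcongr
    have : Nr*1 ≤ Nr*L := by gcongr
    nlinarith
  have a2 : Nr*m^2 ≤ 4*H := by rwa [le_div_iff₀ (by positivity)] at hN
  calc _ ≤ (2 + 6*(Nr*L))*m^4 := by gcongr
    _ = 2*m^4 + 6*((Nr*m^2)*m^2*L) := by ring
    _ ≤ 2*(5*H^2) + 6*((4*H)*(3*H)*L) := by gcongr
    _ ≤ 82*H^2*L := by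
      have : H^2*1 ≤ H^2*L := by gcongr
      nlinarith

theorem count_m2 (R m : ℕ) (hm : 1 ≤ m) (S : Finset P4) (Q H L : ℝ) (hmQ : m ≤ Q) (hH1 : 1 ≤ H)
    (hL : L = 1 + Real.log (19200*H)) (hmH : (m:ℝ)^4 ≤ 5*H^2)
    (hR : ∀ p ∈ S, |p.2.1| ≤ R * p.1) (hHQ : 4*H^3 ≤ Q^2)
    (hq1 : ∀ p ∈ S, Q ≤ p.1) (hq2 : ∀ p ∈ S, (p.1:ℝ) ≤ 2*Q)
    (hA : ∀ p ∈ S, |(p.1:ℝ)*p.2.2.1-p.2.1^2| ≤ H)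
    (hD1 : ∀ p ∈ S, (m:ℤ)^4 ≤ (p.1*p.2.2.2-p.2.1*p.2.2.1)^2 - 4*(p.1*p.2.2.1-p.2.1^2)*(p.2.1*p.2.2.2-p.2.2.1^2))
    (hD2 : ∀ p ∈ S, (p.1*p.2.2.2-p.2.1*p.2.2.1)^2 - 4*(p.1*p.2.2.1-p.2.1^2)*(p.2.1*p.2.2.2-p.2.2.1^2) ≤ 16*(m:ℤ)^4) :
    (S.card:ℝ) ≤ (2*(4*R+1)*(82*111*80^4))*H^2*L^3 := by
  have hmR : (1:ℝ) ≤ m := by exact_mod_cast hm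
  have hm0 : (0:ℝ) < m := by linarith
  have m2H : (m:ℝ)^2 ≤ 3*H := by
    apply le_of_sq_le_sq _ (by positivity)
    nlinarith
  have hL1 : 1 ≤ L := by
    rw [hL]; have := Real.log_nonneg (show (1:ℝ) ≤ 19200*H by linarith); linarith
  have hsb : ∀ n : ℕ, (n:ℝ) ≤ 19200*H → hSum n ≤ L := by
    intro n hn
    refine (hSum_le n).trans ?_
    rw [hL]
    rcases Nat.eq_zero_or_pos n with h0 | h0
    · rw [h0]; simp; exact Real.log_nonneg (by linarith)
    · have := Real.log_le_log (by exact_mod_cast h0) hn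
      linarith
  set N := ⌊4*H/(m:ℝ)^2⌋₊ with hNdef
  have hNle : (N:ℝ) ≤ 4*H/(m:ℝ)^2 := Nat.floor_le (by positivity)
  have hN : ∀ j : ℤ, |(j:ℝ)| * (m:ℝ)^2 ≤ 4*H → |j| ≤ N := by
    intro j hj
    rw [Int.abs_eq_natAbs]
    norm_cast
    apply Nat.le_floor
    rw [le_div_iff₀ (by positivity), Nat.cast_natAbs]
    simpa using hj
  have key := count_m R N m hm S Q H hmQ hR hHQ hq1 hq2 hA hD1 hD2 hN
  have hN4 : (N:ℝ) ≤ 19200*H := by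
    refine hNle.trans ?_
    rw [div_le_iff₀ (by positivity)]
    have : (1:ℝ) ≤ (m:ℝ)^2 := one_le_pow₀ hmR
    nlinarith
  have v1 := arith_v m H L N (hSum N) hmR hH1 hL1 hmH (Nat.cast_nonneg _) hNle (hsb N hN4)
  have hfl : (⌊2 + 4 * (N:ℝ) * hSum N + 2 * N⌋₊:ℝ) ≤ 2 + 4 * (N:ℝ) * hSum N + 2 * N :=
    Nat.floor_le (by have := hSum_nonneg N; positivity)
  have hM2 : (((80*m)^2 : ℕ):ℝ) ≤ 19200*H := by push_cast; nlinarith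
  have hM1 : ((80*m : ℕ):ℝ) ≤ 19200*H := by push_cast; nlinarith
  have f1 : ((fSet (80*m)).card:ℝ) ≤ 111*((80*m)^2)^2*L^2 := by
    apply arith_m ((80*m)^2) (hSum ((80*m)^2)) (hSum (80*m)) L
    · nlinarith
    · exact hL1
    · exact hSum_nonneg _
    · exact hsb _ hM2
    · exact hsb _ hM1
    · refine (fSet_card (80*m)).trans (le_of_eq ?_)
      push_cast; ring
  calc (S.card:ℝ) ≤ 2 * ((4*R+1) * (⌊2 + 4 * (N:ℝ) * hSum N + 2 * N⌋₊:ℝ)) * ((fSet (80*m)).card:ℝ) := by exact_mod_cast key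
    _ ≤ 2 * ((4*R+1) * (2 + 4 * (N:ℝ) * hSum N + 2 * N)) * (111*((80*m)^2)^2*L^2) := by
      gcongr
      have := hSum_nonneg N; positivity
    _ = (2*(4*R+1)*(111*80^4))*L^2*((2 + 4 * (N:ℝ) * hSum N + 2 * N)*m^4) := by ring
    _ ≤ (2*(4*R+1)*(111*80^4))*L^2*(82*H^2*L) := by gcongr
    _ = _ := by ring

theorem count_all (R : ℕ) (S : Finset P4) (Q H L : ℝ) (hQ1 : 1 ≤ Q) (hH1 : 1 ≤ H)
    (hL : L = 1 + Real.log (19200*H))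
    (hR : ∀ p ∈ S, |p.2.1| ≤ R * p.1) (hHQ : 64*H^3 ≤ Q^2)
    (hq1 : ∀ p ∈ S, Q ≤ p.1) (hq2 : ∀ p ∈ S, (p.1:ℝ) ≤ 2*Q)
    (hA : ∀ p ∈ S, |(p.1:ℝ)*p.2.2.1-p.2.1^2| ≤ H)
    (hD1 : ∀ p ∈ S, 1 ≤ (p.1*p.2.2.2-p.2.1*p.2.2.1)^2 - 4*(p.1*p.2.2.1-p.2.1^2)*(p.2.1*p.2.2.2-p.2.2.1^2))
    (hD2 : ∀ p ∈ S, ((p.1:ℝ)*p.2.2.2-p.2.1*p.2.2.1)^2 - 4*(p.1*p.2.2.1-p.2.1^2)*(p.2.1*p.2.2.2-p.2.2.1^2) ≤ 5*H^2) :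
    (S.card:ℝ) ≤ (2*(4*R+1)*(82*111*80^4))*H^2*L^4 := by
  have hlog : 0 ≤ Real.log (19200*H) := Real.log_nonneg (show (1:ℝ) ≤ 19200*H by linarith)
  have hL1 : 1 ≤ L := by rw [hL]; linarith
  set K : ℝ := (2*(4*R+1)*(82*111*80^4))*H^2*L^3 with hK
  have hK0 : 0 ≤ K := by positivity
  set dd : P4 → ℤ := fun p => (p.1*p.2.2.2-p.2.1*p.2.2.1)^2 - 4*(p.1*p.2.2.1-p.2.1^2)*(p.2.1*p.2.2.2-p.2.2.1^2) with hdd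
  set f : P4 → ℕ := fun p => Nat.log 16 (dd p).toNat with hf
  have hlow : ∀ p ∈ S, (16:ℤ)^(f p) ≤ dd p := by
    intro p hp
    have h1 : 1 ≤ dd p := hD1 p hp
    have h2 : 16^(f p) ≤ (dd p).toNat := Nat.pow_log_le_self 16 (by omega)
    have h3 : ((dd p).toNat : ℤ) = dd p := Int.toNat_of_nonneg (by omega)
    rw [← h3]; exact_mod_cast h2
  have hup : ∀ p ∈ S, dd p < (16:ℤ)^(f p+1) := by
    intro p hp
    have h1 : 1 ≤ dd p := hD1 p hp
    have h2 : (dd p).toNat < 16^(f p+1) := Nat.lt_pow_succ_log_self (by norm_num) _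
    have h3 : ((dd p).toNat : ℤ) = dd p := Int.toNat_of_nonneg (by omega)
    rw [← h3]; exact_mod_cast h2
  have hdH : ∀ p ∈ S, ((dd p : ℤ):ℝ) ≤ 5*H^2 := by
    intro p hp
    have := hD2 p hp
    simp only [hdd]; push_cast; exact this
  have hjH : ∀ p ∈ S, (16:ℝ)^(f p) ≤ 5*H^2 := by
    intro p hp
    refine le_trans ?_ (hdH p hp)
    exact_mod_cast hlow p hp
  have hmaps : ∀ p ∈ S, f p ∈ Finset.range ⌊L⌋₊ := by
    intro p hp
    rw [Finset.mem_range, Nat.lt_iff_add_one_le]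
    apply Nat.le_floor
    have h1 := hjH p hp
    have h2 : (16:ℝ)^(f p) ≤ (19200*H)^2 := h1.trans (by nlinarith)
    have h3 := Real.log_le_log (by positivity) h2
    rw [Real.log_pow, Real.log_pow] at h3
    have h4 : (2:ℝ) ≤ Real.log 16 := by
      have : (16:ℝ) = 2^4 := by norm_num
      rw [this, Real.log_pow]
      have := Real.log_two_gt_d9
      push_cast; linarith
    have h5 : (f p:ℝ)*2 ≤ f p * Real.log 16 := by gcongr
    push_cast at h3 ⊢
    rw [hL]; linarith
  have key : S.card ≤ ⌊K⌋₊ * (Finset.range ⌊L⌋₊).card := by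
    refine Finset.card_le_mul_card_image_of_maps_to hmaps _ ?_
    intro j hj
    apply Nat.le_floor
    rcases (S.filter (fun p => f p = j)).eq_empty_or_nonempty with he | ⟨w, hw⟩
    · rw [he]; simpa using hK0
    have hm4 : (((2^j : ℕ)):ℤ)^4 = 16^j := by
      push_cast; rw [← pow_mul, mul_comm, pow_mul]; norm_num
    have hm4R : (((2^j : ℕ)):ℝ)^4 = 16^j := by
      push_cast; rw [← pow_mul, mul_comm, pow_mul]; norm_num
    have hjw : (16:ℝ)^j ≤ 5*H^2 := by
      rw [Finset.mem_filter] at hw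
      have := hjH w hw.1
      rwa [hw.2] at this
    have hH23 : H^2 ≤ H^3 := pow_le_pow_right₀ hH1 (by norm_num)
    have hQ24 : Q^2 ≤ Q^4 := pow_le_pow_right₀ hQ1 (by norm_num)
    have hmQ : ((2^j : ℕ):ℝ) ≤ Q := by
      refine le_of_pow_le_pow_left₀ (n := 4) (by norm_num) (by linarith) ?_
      rw [hm4R]; nlinarith
    have sub : ∀ p ∈ S.filter (fun p => f p = j), p ∈ S := fun p hp => (Finset.mem_filter.1 hp).1
    have eqj : ∀ p ∈ S.filter (fun p => f p = j), f p = j := fun p hp => (Finset.mem_filter.1 hp).2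
    apply count_m2 R (2^j) Nat.one_le_two_pow _ Q H L hmQ hH1 hL (by rw [hm4R]; exact hjw)
      (fun p hp => hR p (sub p hp)) (by nlinarith)
      (fun p hp => hq1 p (sub p hp)) (fun p hp => hq2 p (sub p hp)) (fun p hp => hA p (sub p hp))
    · intro p hp
      rw [hm4, ← eqj p hp]; exact hlow p (sub p hp)
    · intro p hp
      rw [hm4]
      have := hup p (sub p hp)
      rw [eqj p hp, pow_succ] at this
      simp only [hdd] at this
      linarith
  rw [Finset.card_range] at key
  have hLf : (⌊L⌋₊:ℝ) ≤ L := Nat.floor_le (by linarith)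
  calc (S.card:ℝ) ≤ (⌊K⌋₊:ℝ)*(⌊L⌋₊:ℝ) := by exact_mod_cast key
    _ ≤ K*L := by gcongr; exact Nat.floor_le hK0
    _ = _ := by rw [hK]; ring

/-- rationals of bounded height, as a finite set of reals -/
noncomputable def ratSet (A R : ℕ) : Finset ℝ :=
  (Finset.Icc (1:ℤ) A ×ˢ Finset.Icc (-((R:ℤ)*A)) (R*A)).image (fun u => (u.2:ℝ)/u.1)

theorem ratSet_card (A R : ℕ) (hR : 1 ≤ R) : ((ratSet A R).card:ℝ) ≤ 3*R*(A:ℝ)^2 := by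
  have h : (ratSet A R).card ≤ A * (2*(R*A)+1) := by
    refine Finset.card_image_le.trans ?_
    rw [Finset.card_product, Int.card_Icc, Int.card_Icc]
    apply le_of_eq
    congr 1
    · omega
    · have : ((R:ℤ)*A) = ((R*A:ℕ):ℤ) := by push_cast; ring
      rw [this]; omega
  have h2 : A * (2*(R*A)+1) ≤ 3*R*A^2 := by
    rcases Nat.eq_zero_or_pos A with h0 | h0
    · rw [h0]; simp
    · have : 1 ≤ R*A := Nat.mul_pos hR h0
      nlinarith
  exact_mod_cast h.trans h2

theorem mem_ratSet (A R : ℕ) (r : ℚ) (h1 : r.den ≤ A) (h2 : |(r:ℝ)| ≤ R) : (r:ℝ) ∈ ratSet A R := by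
  unfold ratSet
  rw [Finset.mem_image]
  have hd : (0:ℝ) < r.den := by exact_mod_cast r.den_pos
  have hn : |r.num| ≤ (R:ℤ)*A := by
    have e : (r:ℝ) = r.num / r.den := Rat.cast_def r
    rw [e, abs_div, abs_of_pos hd, div_le_iff₀ hd] at h2
    have h3 : |(r.num:ℝ)| ≤ R*A := h2.trans (by gcongr)
    exact_mod_cast h3
  refine ⟨((r.den:ℤ), r.num), ?_, ?_⟩
  · simp only [Finset.mem_product, Finset.mem_Icc]
    refine ⟨⟨by exact_mod_cast r.den_pos, by exact_mod_cast h1⟩, abs_le.1 hn⟩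
  · simp only; rw [Rat.cast_def r]; simp

/-- squares of denominators divide -/
theorem den_pow_dvd (r : ℚ) (n : ℕ) (A C : ℤ) (h : (A:ℚ)*r^n = C) : ((r.den:ℤ)^n) ∣ A := by
  have hd : (r.den:ℚ) ≠ 0 := by exact_mod_cast r.den_ne_zero
  have e : (r.num:ℚ)/r.den = r := Rat.num_div_den r
  have h2 : A * r.num^n = C * (r.den:ℤ)^n := by
    have : (A:ℚ) * r.num^n = C * r.den^n := by
      rw [← h]; nth_rewrite 2 [← e]; rw [div_pow]; field_simp
    exact_mod_cast this
  have hcop : IsCoprime ((r.den:ℤ)^n) (r.num^n) := by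
    apply IsCoprime.pow
    rw [Int.isCoprime_iff_nat_coprime]; simpa using r.reduced.symm
  exact hcop.dvd_of_dvd_mul_right (Dvd.intro_left _ h2.symm)

theorem case_D0 (p0 p1 p2 p3 : ℤ) (H : ℝ) (hA : |(p0:ℝ)*p2-p1^2| ≤ H)
    (hD : (p0*p3-p1*p2)^2 - 4*(p0*p2-p1^2)*(p1*p3-p2^2) = 0) (hA0 : p0*p2-p1^2 ≠ 0) :
    ∃ r : ℚ, r.den ≤ ⌊Real.sqrt H⌋₊ ∧ |(p0:ℝ)*r-p1| ≤ Real.sqrt H := by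
  obtain ⟨A, hAd⟩ : ∃ A, A = p0*p2-p1^2 := ⟨_, rfl⟩
  obtain ⟨B, hBd⟩ : ∃ B, B = p0*p3-p1*p2 := ⟨_, rfl⟩
  obtain ⟨C, hCd⟩ : ∃ C, C = p1*p3-p2^2 := ⟨_, rfl⟩
  have rel : p0*C-p1*B+p2*A = 0 := by rw [hAd, hBd, hCd]; ring
  have hAR : |(A:ℝ)| ≤ H := by rw [hAd]; push_cast; exact hA
  rw [← hAd] at hA0
  rw [← hAd, ← hBd, ← hCd] at hD
  have hAQ : (A:ℚ) ≠ 0 := by exact_mod_cast hA0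
  have hDQ : (B:ℚ)^2 - 4*A*C = 0 := by exact_mod_cast hD
  have relQ : (p0:ℚ)*C-p1*B+p2*A = 0 := by exact_mod_cast rel
  have hAdQ : (A:ℚ) = p0*p2-p1^2 := by exact_mod_cast hAd
  obtain ⟨r, hr⟩ : ∃ r : ℚ, r = B/(2*A) := ⟨_, rfl⟩
  have h1 : (A:ℚ)*r^2 = C := by
    rw [hr, div_pow]; field_simp; linear_combination hDQ
  have h2 : 2*(A:ℚ)*r = B := by rw [hr]; field_simp
  have h3 : ((p0:ℚ)*r-p1)^2 = -A := by
    have : (A:ℚ)*(((p0:ℚ)*r-p1)^2) = A*(-A) := by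
      linear_combination (p0:ℚ)^2*h1 - p0*p1*h2 + p0*relQ + A*hAdQ
    exact mul_left_cancel₀ hAQ this
  refine ⟨r, ?_, ?_⟩
  · have hdvd := den_pow_dvd r 2 A C h1
    have hle : (r.den:ℤ)^2 ≤ |A| := by
      have := Int.le_of_dvd (abs_pos.2 hA0) ((dvd_abs _ _).2 hdvd)
      exact this
    apply Nat.le_floor
    apply Real.le_sqrt_of_sq_le
    refine le_trans ?_ hAR
    exact_mod_cast hle
  · apply Real.abs_le_sqrt
    have : ((p0:ℝ)*r-p1)^2 = -A := by exact_mod_cast h3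
    rw [this]
    exact (neg_le_abs _).trans hAR

theorem case_h0 (p0 p1 p2 p3 : ℤ) (H Q : ℝ) (hp : 0 < p0) (hH : 0 ≤ H) (hQ : p0 ≤ 2*Q) (hQH : 2*Q ≤ H^3)
    (hD : (p0*p3-p1*p2)^2 - 4*(p0*p2-p1^2)*(p1*p3-p2^2) = 0) (hA0 : p0*p2-p1^2 = 0) :
    ∃ r : ℚ, r.den ≤ ⌊H⌋₊ ∧ (r:ℝ) = p1/p0 := by
  rw [hA0] at hD
  have hB : p0*p3-p1*p2 = 0 := by
    have : (p0*p3-p1*p2)^2 = 0 := by linarith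
    exact pow_eq_zero_iff (two_ne_zero) |>.1 this
  have hpQ : (p0:ℚ) ≠ 0 := by exact_mod_cast hp.ne'
  refine ⟨(p1:ℚ)/p0, ?_, by push_cast; rfl⟩
  have hAQ : (p0:ℚ)*p2-p1^2 = 0 := by exact_mod_cast hA0
  have hBQ : (p0:ℚ)*p3-p1*p2 = 0 := by exact_mod_cast hB
  have h1 : (p0:ℚ)*((p1:ℚ)/p0)^3 = p3 := by
    rw [div_pow]; field_simp
    linear_combination (-(p0:ℚ))*hBQ - p1*hAQ
  have hdvd := den_pow_dvd _ 3 p0 p3 h1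
  have hle := Int.le_of_dvd hp hdvd
  apply Nat.le_floor
  refine le_of_pow_le_pow_left₀ (n := 3) (by norm_num) hH ?_
  refine le_trans ?_ (hQ.trans hQH)
  exact_mod_cast hle

theorem abc_bound (x q e1 e2 e3 R Q ε : ℝ) (hR : 1 ≤ R) (hx : |x| ≤ R) (hq0 : 1 ≤ q) (hq : q ≤ 2*Q) (hε : ε ≤ 1)
    (h1 : |e1| ≤ ε) (h2 : |e2| ≤ ε) (h3 : |e3| ≤ ε) :
    |q*(q*x^2+e2) - (q*x+e1)^2| ≤ 12*R^3*Q*ε ∧ |q*(q*x^3+e3) - (q*x+e1)*(q*x^2+e2)| ≤ 12*R^3*Q*ε ∧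
    |(q*x+e1)*(q*x^3+e3) - (q*x^2+e2)^2| ≤ 12*R^3*Q*ε := by
  have hε0 : 0 ≤ ε := (abs_nonneg _).trans h1
  have hx0 := abs_nonneg x
  have hR2 : R ≤ R^2 := by nlinarith
  have hR3 : R^2 ≤ R^3 := by nlinarith [sq_nonneg R]
  have x2 : |x^2| ≤ R^2 := by rw [abs_pow]; gcongr
  have x3 : |x^3| ≤ R^3 := by rw [abs_pow]; gcongr
  have hR30 : 1 ≤ R^3 := one_le_pow₀ hR
  have x1' : |x| ≤ R^3 := by linarith
  have x2' : |x^2| ≤ R^3 := by linarith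
  have hqq : |q| = q := abs_of_pos (by linarith)
  have qe : ∀ y e : ℝ, |y| ≤ R^3 → |e| ≤ ε → |q*(y*e)| ≤ q*(R^3*ε) := by
    intro y e hy he
    rw [abs_mul, abs_mul, hqq]; gcongr
  have ee : ∀ e e' : ℝ, |e| ≤ ε → |e'| ≤ ε → |e*e'| ≤ q*(R^3*ε) := by
    intro e e' he he'
    rw [abs_mul]
    have : q*(R^3*ε) ≥ 1*(1*ε) := by gcongr
    calc |e| * |e'| ≤ ε*1 := by gcongr; exact he'.trans hε
      _ ≤ _ := by linarith
  have fin : q*(R^3*ε) ≤ 2*(R^3*Q*ε) := by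
    have : q*(R^3*ε) ≤ (2*Q)*(R^3*ε) := by gcongr
    linarith
  have one : |(1:ℝ)| ≤ R^3 := by simpa using hR30
  refine ⟨?_, ?_, ?_⟩
  · have e : q*(q*x^2+e2) - (q*x+e1)^2 = q*(1*e2) - (2*(q*(x*e1))) - e1*e1 := by ring
    rw [e]
    have a1 := abs_le.1 (qe 1 e2 one h2)
    have a2 := abs_le.1 (qe x e1 x1' h1)
    have a3 := abs_le.1 (ee e1 e1 h1 h1)
    rw [abs_le]; constructor <;> linarith
  · have e : q*(q*x^3+e3) - (q*x+e1)*(q*x^2+e2) = q*(1*e3) - q*(x*e2) - q*(x^2*e1) - e1*e2 := by ring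
    rw [e]
    have a1 := abs_le.1 (qe 1 e3 one h3)
    have a2 := abs_le.1 (qe x e2 x1' h2)
    have a3 := abs_le.1 (qe (x^2) e1 x2' h1)
    have a4 := abs_le.1 (ee e1 e2 h1 h2)
    rw [abs_le]; constructor <;> linarith
  · have e : (q*x+e1)*(q*x^3+e3) - (q*x^2+e2)^2 = q*(x*e3) + q*(x^3*e1) - 2*(q*(x^2*e2)) + (e1*e3-e2*e2) := by ring
    rw [e]
    have a1 := abs_le.1 (qe x e3 x1' h3)
    have a2 := abs_le.1 (qe (x^3) e1 x3 h1)
    have a3 := abs_le.1 (qe (x^2) e2 x2' h2)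
    have a4 := abs_le.1 (ee e1 e3 h1 h3)
    have a5 := abs_le.1 (ee e2 e2 h2 h2)
    rw [abs_le]; constructor <;> linarith

noncomputable def ptSet (k R : ℕ) (H : ℝ) : Finset P4 := by
  classical
  exact (Finset.Icc ((2:ℤ)^k) (2*2^k) ×ˢ Finset.Icc (-(2*2^k*(R^3+1):ℤ)) (2*2^k*(R^3+1)) ×ˢ
    Finset.Icc (-(2*2^k*(R^3+1):ℤ)) (2*2^k*(R^3+1)) ×ˢ
    Finset.Icc (-(2*2^k*(R^3+1):ℤ)) (2*2^k*(R^3+1))).filter (fun p : P4 =>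
      |p.2.1| ≤ (R+1 : ℕ) * p.1 ∧ |(p.1:ℝ)*p.2.2.1-p.2.1^2| ≤ H ∧
      1 ≤ (p.1*p.2.2.2-p.2.1*p.2.2.1)^2 - 4*(p.1*p.2.2.1-p.2.1^2)*(p.2.1*p.2.2.2-p.2.2.1^2) ∧
      ((p.1:ℝ)*p.2.2.2-p.2.1*p.2.2.1)^2 - 4*(p.1*p.2.2.1-p.2.1^2)*(p.2.1*p.2.2.2-p.2.2.1^2) ≤ 5*H^2)

theorem ptSet_card (k R : ℕ) (H L : ℝ) (hH1 : 1 ≤ H) (hL : L = 1 + Real.log (19200*H))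
    (hHQ : 64*H^3 ≤ ((2:ℝ)^k)^2) :
    ((ptSet k R H).card:ℝ) ≤ (2*(4*(R+1:ℕ)+1)*(82*111*80^4))*H^2*L^4 := by
  classical
  have hm : ∀ p ∈ ptSet k R H, ((2:ℤ)^k ≤ p.1 ∧ p.1 ≤ 2*2^k) ∧ |p.2.1| ≤ (R+1 : ℕ) * p.1 ∧ |(p.1:ℝ)*p.2.2.1-p.2.1^2| ≤ H ∧
      1 ≤ (p.1*p.2.2.2-p.2.1*p.2.2.1)^2 - 4*(p.1*p.2.2.1-p.2.1^2)*(p.2.1*p.2.2.2-p.2.2.1^2) ∧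
      ((p.1:ℝ)*p.2.2.2-p.2.1*p.2.2.1)^2 - 4*(p.1*p.2.2.1-p.2.1^2)*(p.2.1*p.2.2.2-p.2.2.1^2) ≤ 5*H^2 := by
    intro p hp
    unfold ptSet at hp
    rw [Finset.mem_filter, Finset.mem_product, Finset.mem_Icc] at hp
    exact ⟨hp.1.1, hp.2⟩
  apply count_all (R+1) (ptSet k R H) ((2:ℝ)^k) H L (one_le_pow₀ (by norm_num)) hH1 hL
    (fun p hp => (hm p hp).2.1) hHQ
  · intro p hp
    have := (hm p hp).1.1
    exact_mod_cast this
  · intro p hp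
    have := (hm p hp).1.2
    exact_mod_cast this
  · exact fun p hp => (hm p hp).2.2.1
  · exact fun p hp => (hm p hp).2.2.2.1
  · exact fun p hp => (hm p hp).2.2.2.2

theorem cover_k (k R : ℕ) (ε H L : ℝ) (hR : 1 ≤ R) (hε0 : 0 < ε) (hε : ε ≤ 1) 
    (hHe : H = 12*R^3*2^k*ε) (hH1 : 1 ≤ H) (hL : L = 1 + Real.log (19200*H))
    (hHQ : 64*H^3 ≤ ((2:ℝ)^k)^2) (hQH : 2*(2:ℝ)^k ≤ H^3) :
    ∃ J1 J2 : Finset ℝ, (J1.card:ℝ) ≤ (2*(4*(R+1:ℕ)+1)*(82*111*80^4))*H^2*L^4 + 3*(R+1:ℕ)*H^2 ∧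
      (J2.card:ℝ) ≤ 3*(R+1:ℕ)*H ∧ ∀ x : ℝ, |x| ≤ R → ∀ p0 p1 p2 p3 : ℤ, (2:ℤ)^k ≤ p0 → p0 ≤ 2*2^k →
      |p0*x-p1| ≤ ε → |p0*x^2-p2| ≤ ε → |p0*x^3-p3| ≤ ε →
      (∃ c ∈ J1, |x-c| ≤ ε/2^k) ∨ (∃ c ∈ J2, |x-c| ≤ 2*Real.sqrt H/2^k) := by
  classical
  have hH0 : 0 ≤ H := by linarith
  have hsH : 1 ≤ Real.sqrt H := Real.one_le_sqrt.2 hH1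
  refine ⟨(ptSet k R H).image (fun p => (p.2.1:ℝ)/p.1) ∪ ratSet ⌊H⌋₊ (R+1), ratSet ⌊Real.sqrt H⌋₊ (R+1), ?_, ?_, ?_⟩
  · have h1 : (((ptSet k R H).image (fun p => (p.2.1:ℝ)/p.1) ∪ ratSet ⌊H⌋₊ (R+1)).card:ℝ) ≤
      (ptSet k R H).card + (ratSet ⌊H⌋₊ (R+1)).card := by
      exact_mod_cast (Finset.card_union_le _ _).trans (Nat.add_le_add_right Finset.card_image_le _)
    have h2 := ptSet_card k R H L hH1 hL hHQ
    have h3 := ratSet_card ⌊H⌋₊ (R+1) (by omega)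
    have h4 : (⌊H⌋₊:ℝ) ≤ H := Nat.floor_le hH0
    have h5 : 3*((R+1:ℕ):ℝ)*(⌊H⌋₊:ℝ)^2 ≤ 3*((R+1:ℕ):ℝ)*H^2 := by gcongr
    linarith
  · have h3 := ratSet_card ⌊Real.sqrt H⌋₊ (R+1) (by omega)
    have h4 : (⌊Real.sqrt H⌋₊:ℝ) ≤ Real.sqrt H := Nat.floor_le (by linarith)
    have h5 : 3*((R+1:ℕ):ℝ)*(⌊Real.sqrt H⌋₊:ℝ)^2 ≤ 3*((R+1:ℕ):ℝ)*(Real.sqrt H)^2 := by gcongr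
    rw [Real.sq_sqrt hH0] at h5
    linarith
  · intro x hx p0 p1 p2 p3 hq1 hq2 h1 h2 h3
    have hRR : (1:ℝ) ≤ R := by exact_mod_cast hR
    have hQ1 : (1:ℝ) ≤ 2^k := one_le_pow₀ (by norm_num)
    have hq1R : (2:ℝ)^k ≤ p0 := by exact_mod_cast hq1
    have hq2R : (p0:ℝ) ≤ 2*2^k := by exact_mod_cast hq2
    have hp1 : (1:ℝ) ≤ p0 := by linarith
    have hpZ : 0 < p0 := lt_of_lt_of_le (by positivity) hq1
    have hpR : (0:ℝ) < p0 := by linarith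
    have hQ0 : (0:ℝ) < 2^k := by linarith
    -- the basic bounds
    obtain ⟨bA, bB, bC⟩ := abc_bound x p0 (p1-p0*x) (p2-p0*x^2) (p3-p0*x^3) R (2^k) ε hRR hx hp1 hq2R hε
      (by rw [abs_sub_comm]; exact h1) (by rw [abs_sub_comm]; exact h2) (by rw [abs_sub_comm]; exact h3)
    rw [← hHe] at bA bB bC
    have bA : |(p0:ℝ)*p2-p1^2| ≤ H := by convert bA using 2; ring
    have bB : |(p0:ℝ)*p3-p1*p2| ≤ H := by convert bB using 2; ring
    have bC : |(p1:ℝ)*p3-p2^2| ≤ H := by convert bC using 2; ring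
    have hdist : |x - p1/p0| ≤ ε/2^k := by
      have e : x - p1/p0 = (p0*x-p1)/p0 := by field_simp
      rw [e, abs_div, abs_of_pos hpR]
      gcongr
    have hD5 : ((p0:ℝ)*p3-p1*p2)^2 - 4*(p0*p2-p1^2)*(p1*p3-p2^2) ≤ 5*H^2 := by
      have t1 : ((p0:ℝ)*p3-p1*p2)^2 ≤ H^2 := by rw [← sq_abs]; gcongr
      have t2 : |((p0:ℝ)*p2-p1^2)*(p1*p3-p2^2)| ≤ H*H := by rw [abs_mul]; gcongr
      have := (abs_le.1 t2).1
      linarith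
    have hp1b : |(p1:ℝ)| ≤ (R+1)*p0 := by
      have e : (p1:ℝ) = p0*x - (p0*x-p1) := by ring
      rw [e]
      have t1 := abs_sub ((p0:ℝ)*x) (p0*x-p1)
      have t2 : |(p0:ℝ)*x| ≤ p0*R := by rw [abs_mul, abs_of_pos hpR]; gcongr
      nlinarith
    have hrat : ∀ r : ℝ, |x-r| ≤ 1 → |r| ≤ ((R+1:ℕ):ℝ) := by
      intro r hr
      push_cast
      have e : r = x - (x - r) := by ring
      have := abs_sub x (x-r)
      rw [← e] at this
      linarith
    obtain ⟨D, hDd⟩ : ∃ D, D = (p0*p3-p1*p2)^2 - 4*(p0*p2-p1^2)*(p1*p3-p2^2) := ⟨_, rfl⟩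
    rcases lt_trichotomy D 0 with hD | hD | hD
    · exfalso
      have syz : ((p0:ℝ)^2*p3-3*p0*p1*p2+2*p1^3)^2 = p0^2*D - 4*(p0*p2-p1^2)^3 := by
        rw [hDd]; push_cast; ring
      have hD1 : (D:ℝ) ≤ -1 := by exact_mod_cast (by omega : D ≤ -1)
      have c1 : -(H^3) ≤ ((p0:ℝ)*p2-p1^2)^3 := by
        have : (-H)^3 ≤ ((p0:ℝ)*p2-p1^2)^3 :=
          (Odd.strictMono_pow (R := ℝ) (n := 3) (by decide)).monotone (abs_le.1 bA).1
        calc -(H^3) = (-H)^3 := by ring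
          _ ≤ _ := this
      have c2 : (p0:ℝ)^2*D ≤ p0^2*(-1) := by gcongr
      have c3 : ((2:ℝ)^k)^2 ≤ (p0:ℝ)^2 := by gcongr
      have c4 : 0 < ((2:ℝ)^k)^2 := by positivity
      have c5 := sq_nonneg ((p0:ℝ)^2*p3-3*p0*p1*p2+2*p1^3)
      rw [syz] at c5
      linarith
    · by_cases hA0 : p0*p2-p1^2 = 0
      · left
        obtain ⟨r, hr1, hr2⟩ := case_h0 p0 p1 p2 p3 H (2^k) hpZ hH0 hq2R hQH (by rw [← hDd, hD]) hA0
        refine ⟨r, Finset.mem_union_right _ (mem_ratSet _ _ r hr1 ?_), by rw [hr2]; exact hdist⟩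
        apply hrat
        rw [hr2]
        refine hdist.trans ?_
        rw [div_le_one hQ0]; linarith
      · right
        obtain ⟨r, hr1, hr2⟩ := case_D0 p0 p1 p2 p3 H bA (by rw [← hDd, hD]) hA0
        have hxr : |x-r| ≤ 2*Real.sqrt H/2^k := by
          have e : x - r = (x - p1/p0) - (p0*r-p1)/p0 := by field_simp; ring
          have t1 : |((p0:ℝ)*r-p1)/p0| ≤ Real.sqrt H/2^k := by
            rw [abs_div, abs_of_pos hpR]; gcongr
          have t2 : ε/2^k ≤ Real.sqrt H/2^k := by gcongr; linarith
          rw [e]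
          have t3 := abs_sub (x - p1/p0) (((p0:ℝ)*r-p1)/p0)
          have t4 : 2*Real.sqrt H/2^k = Real.sqrt H/2^k + Real.sqrt H/2^k := by ring
          linarith
        refine ⟨r, mem_ratSet _ _ r hr1 (hrat _ (hxr.trans ?_)), hxr⟩
        rw [div_le_one hQ0]
        apply le_of_sq_le_sq _ hQ0.le
        rw [mul_pow, Real.sq_sqrt hH0]
        have : H ≤ H^3 := le_self_pow₀ hH1 (by norm_num)
        linarith
    · left
      refine ⟨p1/p0, Finset.mem_union_left _ ?_, hdist⟩
      rw [Finset.mem_image]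
      refine ⟨(p0, p1, p2, p3), ?_, rfl⟩
      have box : ∀ (y : ℝ) (p : ℤ), |y| ≤ (R:ℝ)^3 → |p0*y-p| ≤ ε → |p| ≤ 2*2^k*(R^3+1) := by
        intro y p hy hp
        have t0 : |(p:ℝ)| ≤ 2*2^k*(R^3+1) := by
          have e : (p:ℝ) = p0*y - (p0*y-p) := by ring
          rw [e]
          have t1 := abs_sub ((p0:ℝ)*y) (p0*y-p)
          have t2 : |(p0:ℝ)*y| ≤ (2*2^k)*R^3 := by rw [abs_mul, abs_of_pos hpR]; gcongr
          linarith
        exact_mod_cast t0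
      have hR30 : 1 ≤ (R:ℝ)^2 := one_le_pow₀ hRR
      have y1 : |x| ≤ (R:ℝ)^3 := hx.trans (le_self_pow₀ hRR (by norm_num))
      have y2 : |x^2| ≤ (R:ℝ)^3 := by
        rw [abs_pow]
        exact (pow_le_pow_left₀ (abs_nonneg _) hx 2).trans (pow_le_pow_right₀ hRR (by norm_num))
      have y3 : |x^3| ≤ (R:ℝ)^3 := by
        rw [abs_pow]
        exact (pow_le_pow_left₀ (abs_nonneg _) hx 3)
      unfold ptSet
      rw [Finset.mem_filter]
      simp only [Finset.mem_product, Finset.mem_Icc]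
      refine ⟨⟨⟨hq1, hq2⟩, abs_le.1 (box x p1 y1 h1), abs_le.1 (box _ p2 y2 h2), abs_le.1 (box _ p3 y3 h3)⟩, ?_, bA, ?_, hD5⟩
      · exact_mod_cast hp1b
      · rw [← hDd]; omega

theorem bc_null (d : ℝ) (hd : 0 < d) (J : ℕ → Finset ℝ) (r : ℕ → ℝ) (hr0 : ∀ k, 0 ≤ r k) (hanti : Antitone r)
    (hr : Filter.Tendsto r Filter.atTop (nhds 0))
    (hsum : Summable (fun k => ((J k).card:ℝ) * (2 * r k)^d)) :
    μH[d] {x : ℝ | ∃ᶠ k in Filter.atTop, ∃ c ∈ J k, |x - c| ≤ r k} = 0 := by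
  set f : ℕ → ℝ≥0∞ := fun k => ENNReal.ofReal (((J k).card:ℝ) * (2 * r k)^d) with hf
  have hft : ∑' k, f k ≠ ⊤ := hsum.tsum_ofReal_ne_top
  have hlim := ENNReal.tendsto_sum_nat_add f hft
  have key := Measure.hausdorffMeasure_le_liminf_tsum (X := ℝ) (β := ℕ) (ι := fun n => Σ k : ℕ, (J (k+n))) d
    {x : ℝ | ∃ᶠ k in Filter.atTop, ∃ c ∈ J k, |x - c| ≤ r k} (l := Filter.atTop)
    (fun n => ENNReal.ofReal (2 * r n)) (by
      have := (ENNReal.tendsto_ofReal ((hr.const_mul 2)))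
      simpa using this)
    (fun n i => Set.Icc ((i.2:ℝ) - r (i.1+n)) ((i.2:ℝ) + r (i.1+n)))
    (by
      refine Filter.Eventually.of_forall (fun n i => ?_)
      rw [Real.ediam_Icc]
      apply ENNReal.ofReal_le_ofReal
      have := hanti (show n ≤ i.1 + n by omega)
      linarith)
    (by
      refine Filter.Eventually.of_forall (fun n x hx => ?_)
      rw [Set.mem_setOf_eq, Filter.frequently_atTop] at hx
      obtain ⟨k, hk, c, hc, hxc⟩ := hx n
      rw [Set.mem_iUnion]
      obtain ⟨j, rfl⟩ : ∃ j, k = j + n := ⟨k - n, by omega⟩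
      refine ⟨⟨j, ⟨c, hc⟩⟩, ?_⟩
      have := abs_le.1 hxc
      simp only [Set.mem_Icc]
      constructor <;> linarith)
  have e : ∀ n, ∑' i : (Σ k : ℕ, (J (k+n))), Metric.ediam (Set.Icc ((i.2:ℝ) - r (i.1+n)) ((i.2:ℝ) + r (i.1+n))) ^ d =
      ∑' k, f (k+n) := by
    intro n
    rw [ENNReal.tsum_sigma']
    congr 1
    ext k
    rw [tsum_fintype]
    have e2 : ∀ y : ℝ, y + r (k+n) - (y - r (k+n)) = 2 * r (k+n) := fun y => by ring
    simp only [Real.ediam_Icc, e2]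
    rw [Finset.sum_const, hf]
    simp only [Finset.card_univ, Fintype.card_coe, nsmul_eq_mul]
    rw [ENNReal.ofReal_mul (p := ((J (k+n)).card:ℝ)) (by positivity), ENNReal.ofReal_natCast,
      ENNReal.ofReal_rpow_of_nonneg (by have := hr0 (k+n); linarith) hd.le]
  simp only [e] at key
  rw [hlim.liminf_eq] at key
  exact nonpos_iff_eq_zero.1 key

theorem summ_aux (η : ℝ) (hη : 0 < η) : Summable (fun k : ℕ => ((k:ℝ)+1)^4 * (2:ℝ)^(-η*k)) := by
  set θ : ℝ := (2:ℝ)^(-η) with hθ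
  have hθ0 : 0 < θ := by positivity
  have hθ1 : θ < 1 := Real.rpow_lt_one_of_one_lt_of_neg (by norm_num) (by linarith)
  have h1 := summable_pow_mul_geometric_of_norm_lt_one (R := ℝ) 4 (r := θ) (by rw [Real.norm_eq_abs, abs_of_pos hθ0]; exact hθ1)
  have h2 := ((summable_nat_add_iff 1).2 h1).mul_left θ⁻¹
  refine h2.congr ?_
  intro k
  rw [Real.rpow_mul (by norm_num), Real.rpow_natCast, ← hθ]
  push_cast
  field_simp
  ring

theorem sim_freq (I : Set ℝ) (lam : ℝ) (hl : 0 < lam) (x : ℝ) (hx : x ∈ SimSet 3 I lam) :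
    ∃ᶠ k : ℕ in Filter.atTop, ∃ p0 p1 p2 p3 : ℤ, (2:ℤ)^k ≤ p0 ∧ p0 ≤ 2*2^k ∧
      |p0*x-p1| ≤ (2:ℝ)^(-lam*k) ∧ |p0*x^2-p2| ≤ (2:ℝ)^(-lam*k) ∧ |p0*x^3-p3| ≤ (2:ℝ)^(-lam*k) := by
  obtain ⟨_, hx⟩ := hx
  unfold simExponent at hx
  rw [lt_sSup_iff] at hx
  obtain ⟨_, ⟨l, ⟨_, hinf⟩, rfl⟩, hll⟩ := hx
  have hll : lam < l := (ENNReal.ofReal_lt_ofReal_iff_of_nonneg hl.le).1 hll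
  rw [Filter.frequently_atTop]
  intro k0
  obtain ⟨q, ⟨hq0, hq⟩, hqk⟩ := hinf.exists_gt (2^k0)
  refine ⟨Nat.log 2 q, ?_, q, round ((q:ℝ)*x), round ((q:ℝ)*x^2), round ((q:ℝ)*x^3), ?_, ?_, ?_⟩
  · exact Nat.le_log_of_pow_le (by norm_num) hqk.le
  · exact_mod_cast Nat.pow_log_le_self 2 hq0.ne'
  · have := (Nat.lt_pow_succ_log_self (b := 2) (by norm_num) q).le
    rw [pow_succ] at this
    have h2 : q ≤ 2 * 2^(Nat.log 2 q) := by linarith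
    exact_mod_cast h2
  · have hq1 : (1:ℝ) ≤ q := by exact_mod_cast hq0
    have hb : (q:ℝ)^(-l) ≤ (2:ℝ)^(-lam*(Nat.log 2 q:ℕ)) := by
      calc (q:ℝ)^(-l) ≤ (q:ℝ)^(-lam) := Real.rpow_le_rpow_of_exponent_le hq1 (by linarith)
        _ ≤ ((2:ℝ)^(Nat.log 2 q))^(-lam) := by
          apply Real.rpow_le_rpow_of_nonpos (by positivity) _ (by linarith)
          exact_mod_cast Nat.pow_log_le_self 2 hq0.ne'
        _ = _ := by
          rw [← Real.rpow_natCast, ← Real.rpow_mul (by norm_num)]; congr 1; ring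
    have H : ∀ i ∈ Finset.Icc 1 3, |(q:ℝ)*x^i - round ((q:ℝ)*x^i)| ≤ (2:ℝ)^(-lam*(Nat.log 2 q:ℕ)) :=
      fun i hi => (hq i hi).trans hb
    have H1 := H 1 (by simp)
    have H2 := H 2 (by simp)
    have H3 := H 3 (by simp)
    rw [pow_one] at H1
    push_cast
    exact ⟨H1, H2, H3⟩

theorem bc_pow (s a b C D : ℝ) (hs : 0 < s) (hb : 0 < b) (hD : 0 ≤ D) (hab : a < b*s)
    (J : ℕ → Finset ℝ) (hJ : ∀ k, ((J k).card:ℝ) ≤ C * ((k:ℝ)+1)^4 * (2:ℝ)^(a*k)) :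
    μH[s] {x : ℝ | ∃ᶠ k : ℕ in Filter.atTop, ∃ c ∈ J k, |x - c| ≤ D * (2:ℝ)^(-b*k)} = 0 := by
  apply bc_null s hs J (fun k : ℕ => D * (2:ℝ)^(-b*k))
  · intro k; positivity
  · intro k l hkl
    simp only
    apply mul_le_mul_of_nonneg_left _ hD
    apply Real.rpow_le_rpow_of_exponent_le (by norm_num)
    have : (k:ℝ) ≤ l := by exact_mod_cast hkl
    nlinarith
  · have h1 : (2:ℝ)^(-b) < 1 := Real.rpow_lt_one_of_one_lt_of_neg (by norm_num) (by linarith)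
    have h2 := (tendsto_pow_atTop_nhds_zero_of_lt_one (by positivity) h1).const_mul D
    rw [mul_zero] at h2
    refine h2.congr ?_
    intro k
    rw [Real.rpow_mul (by norm_num), Real.rpow_natCast]
  · have hsum := (summ_aux (b*s-a) (by linarith)).mul_left (C * (2*D)^s)
    refine Summable.of_nonneg_of_le (fun k => by positivity) (fun k => ?_) hsum
    have e : (2*(D * (2:ℝ)^(-b*k)))^s = (2*D)^s * (2:ℝ)^(-b*k*s) := by
      rw [← mul_assoc, Real.mul_rpow (by positivity) (by positivity), ← Real.rpow_mul (by norm_num)]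
    rw [e]
    calc ((J k).card:ℝ) * ((2*D)^s * (2:ℝ)^(-b*k*s)) ≤
        (C * ((k:ℝ)+1)^4 * (2:ℝ)^(a*k)) * ((2*D)^s * (2:ℝ)^(-b*k*s)) := by
          gcongr; exact hJ k
      _ = C * (2*D)^s * (((k:ℝ)+1)^4 * ((2:ℝ)^(a*k) * (2:ℝ)^(-b*k*s))) := by ring
      _ = _ := by
        rw [← Real.rpow_add (by norm_num)]
        congr 3; ring

theorem main_R (I : Set ℝ) (lam : ℝ) (h1 : 1/2 ≤ lam) (h2 : lam ≤ 3/5) (R : ℕ) (hR : 1 ≤ R) (s : ℝ)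
    (hs : (4-2*lam)/(3*(1+lam)) < s) : μH[s] (SimSet 3 I lam ∩ {x | |x| ≤ R}) = 0 := by
  have hs' : 4-2*lam < s*(3*(1+lam)) := by rwa [div_lt_iff₀ (by linarith)] at hs
  have hs0 : 0 < s := lt_trans (div_pos (by linarith) (by linarith)) hs
  have hRR : (1:ℝ) ≤ R := by exact_mod_cast hR
  obtain ⟨c, hc⟩ : ∃ c : ℝ, c = 12*R^3 := ⟨_, rfl⟩
  have hc1 : 2 ≤ c := by
    have : 1 ≤ (R:ℝ)^3 := one_le_pow₀ hRR
    rw [hc]; linarith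
  obtain ⟨H, hH⟩ : ∃ H : ℕ → ℝ, ∀ k, H k = c * (2:ℝ)^((1-lam)*k) := ⟨_, fun _ => rfl⟩
  have hpow : ∀ k : ℕ, (2:ℝ)^k = (2:ℝ)^(k:ℝ) := fun k => (Real.rpow_natCast _ _).symm
  have hH2 : ∀ k : ℕ, H k = 12*R^3*2^k*(2:ℝ)^(-lam*k) := by
    intro k
    rw [hH, hc, hpow, mul_assoc _ ((2:ℝ)^(k:ℝ)), ← Real.rpow_add (by norm_num)]
    congr 2; ring
  have hg1 : ∀ k : ℕ, 1 ≤ (2:ℝ)^((1-lam)*k) := by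
    intro k
    apply Real.one_le_rpow (by norm_num)
    have : (0:ℝ) ≤ k := by positivity
    nlinarith
  have hH1 : ∀ k, 1 ≤ H k := by
    intro k; rw [hH]; nlinarith [hg1 k]
  have hε1 : ∀ k : ℕ, (2:ℝ)^(-lam*k) ≤ 1 := by
    intro k
    apply Real.rpow_le_one_of_one_le_of_nonpos (by norm_num)
    have : (0:ℝ) ≤ k := by positivity
    nlinarith
  have hH3 : ∀ k : ℕ, (H k)^3 = c^3 * (2:ℝ)^(3*(1-lam)*k) := by
    intro k
    rw [hH, mul_pow, ← Real.rpow_natCast ((2:ℝ)^((1-lam)*k)), ← Real.rpow_mul (by norm_num)]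
    congr 2; push_cast; ring
  have hQH : ∀ k : ℕ, 2*(2:ℝ)^k ≤ (H k)^3 := by
    intro k
    rw [hH3, hpow]
    have c3 : 2 ≤ c^3 := by nlinarith [mul_self_nonneg c, sq_nonneg (c-2)]
    have : (2:ℝ)^(k:ℝ) ≤ (2:ℝ)^(3*(1-lam)*k) := by
      apply Real.rpow_le_rpow_of_exponent_le (by norm_num)
      have : (0:ℝ) ≤ k := by positivity
      nlinarith
    gcongr
  obtain ⟨k0, hk0⟩ : ∃ k0 : ℕ, ∀ k ≥ k0, 64*c^3 ≤ (2:ℝ)^((1/2:ℝ)*k) := by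
    have hone : (1:ℝ) < (2:ℝ)^(1/2:ℝ) := Real.one_lt_rpow (by norm_num) (by norm_num)
    have ht := tendsto_pow_atTop_atTop_of_one_lt hone
    have := (ht.eventually_ge_atTop (64*c^3))
    rw [Filter.eventually_atTop] at this
    obtain ⟨k0, h⟩ := this
    refine ⟨k0, fun k hk => ?_⟩
    rw [Real.rpow_mul (by norm_num), Real.rpow_natCast]
    exact h k hk
  have hHQ : ∀ k ≥ k0, 64*(H k)^3 ≤ ((2:ℝ)^k)^2 := by
    intro k hk
    rw [hH3, hpow, ← Real.rpow_natCast ((2:ℝ)^(k:ℝ)), ← Real.rpow_mul (by norm_num)]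
    calc 64*(c^3 * (2:ℝ)^(3*(1-lam)*k)) = 64*c^3 * (2:ℝ)^(3*(1-lam)*k) := by ring
      _ ≤ (2:ℝ)^((1/2:ℝ)*k) * (2:ℝ)^(3*(1-lam)*k) := by gcongr; exact hk0 k hk
      _ = (2:ℝ)^((1/2:ℝ)*k+3*(1-lam)*k) := by rw [Real.rpow_add (by norm_num)]
      _ ≤ _ := by
        apply Real.rpow_le_rpow_of_exponent_le (by norm_num)
        have : (0:ℝ) ≤ k := by positivity
        push_cast
        nlinarith
  obtain ⟨L0, hL0⟩ : ∃ L0 : ℝ, L0 = 1 + Real.log (19200*c) := ⟨_, rfl⟩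
  have hL01 : 1 ≤ L0 := by
    rw [hL0]; have := Real.log_nonneg (show (1:ℝ) ≤ 19200*c by linarith); linarith
  have hL : ∀ k : ℕ, 1 + Real.log (19200*H k) ≤ L0*((k:ℝ)+1) := by
    intro k
    have hk : (0:ℝ) ≤ k := by positivity
    rw [hH, ← mul_assoc, Real.log_mul (by positivity) (by positivity), Real.log_rpow (by norm_num), ← add_assoc, ← hL0]
    have hl2 : Real.log 2 ≤ 1 := by have := Real.log_two_lt_d9; linarith
    have hl20 : 0 ≤ Real.log 2 := Real.log_nonneg (by norm_num)
    have t1 : (1-lam)*k*Real.log 2 ≤ 1*k*1 := by gcongr; linarith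
    have t2 : 1*(k:ℝ) ≤ L0*k := by gcongr
    linarith
  have hLL1 : ∀ k, 1 ≤ 1 + Real.log (19200*H k) := by
    intro k
    have := Real.log_nonneg (show (1:ℝ) ≤ 19200*H k by linarith [hH1 k])
    linarith
  obtain ⟨K1, hK1⟩ : ∃ K1 : ℝ, K1 = (2*(4*(R+1:ℕ)+1)*(82*111*80^4)) := ⟨_, rfl⟩
  have hK10 : 0 ≤ K1 := by rw [hK1]; positivity
  obtain ⟨K2, hK2⟩ : ∃ K2 : ℝ, K2 = 3*(R+1:ℕ) := ⟨_, rfl⟩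
  have hK20 : 0 ≤ K2 := by rw [hK2]; positivity
  have ex : ∀ k : ℕ, ∃ J1 J2 : Finset ℝ, (J1.card:ℝ) ≤ K1*(H k)^2*(1 + Real.log (19200*H k))^4 + K2*(H k)^2 ∧
      (J2.card:ℝ) ≤ K2*H k ∧ (k0 ≤ k → ∀ x : ℝ, |x| ≤ R → ∀ p0 p1 p2 p3 : ℤ, (2:ℤ)^k ≤ p0 → p0 ≤ 2*2^k →
      |p0*x-p1| ≤ (2:ℝ)^(-lam*k) → |p0*x^2-p2| ≤ (2:ℝ)^(-lam*k) → |p0*x^3-p3| ≤ (2:ℝ)^(-lam*k) →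
      (∃ c ∈ J1, |x-c| ≤ (2:ℝ)^(-lam*k)/2^k) ∨ (∃ c ∈ J2, |x-c| ≤ 2*Real.sqrt (H k)/2^k)) := by
    intro k
    have hHk := hH1 k
    have hLk := hLL1 k
    by_cases hk : k0 ≤ k
    · obtain ⟨J1, J2, a1, a2, a3⟩ := cover_k k R ((2:ℝ)^(-lam*k)) (H k) _ hR (by positivity) (hε1 k) (hH2 k) hHk rfl
        (hHQ k hk) (hQH k)
      rw [← hK1, ← hK2] at a1
      rw [← hK2] at a2
      exact ⟨J1, J2, a1, a2, fun _ => a3⟩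
    · refine ⟨∅, ∅, ?_, ?_, fun h => absurd h hk⟩
      · simp only [Finset.card_empty, Nat.cast_zero]; positivity
      · simp only [Finset.card_empty, Nat.cast_zero]; positivity
  choose J1 J2 c1 c2 cov using ex
  have z1 := bc_pow s (2*(1-lam)) (1+lam) ((K1+K2)*c^2*L0^4) 1 hs0 (by linarith) (by norm_num) (by nlinarith) J1 (by
    intro k
    have e : (H k)^2 = c^2 * (2:ℝ)^(2*(1-lam)*k) := by
      rw [hH, mul_pow, ← Real.rpow_natCast ((2:ℝ)^((1-lam)*k)), ← Real.rpow_mul (by norm_num)]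
      congr 2; push_cast; ring
    have hLk := hLL1 k
    have hL4 : 1 ≤ (1 + Real.log (19200*H k))^4 := one_le_pow₀ hLk
    have hL4' : (1 + Real.log (19200*H k))^4 ≤ (L0*((k:ℝ)+1))^4 := by gcongr; exact hL k
    calc ((J1 k).card:ℝ) ≤ K1*(H k)^2*(1 + Real.log (19200*H k))^4 + K2*(H k)^2*1 := by rw [mul_one]; exact c1 k
      _ ≤ K1*(H k)^2*(L0*((k:ℝ)+1))^4 + K2*(H k)^2*(L0*((k:ℝ)+1))^4 := by
        gcongr; exact hL4.trans hL4'
      _ = _ := by rw [e]; ring)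
  have z2 := bc_pow s (1-lam) ((1+lam)/2) (K2*c) (2*Real.sqrt c) hs0 (by linarith) (by positivity) (by nlinarith) J2 (by
    intro k
    have hk1 : (1:ℝ) ≤ ((k:ℝ)+1)^4 := one_le_pow₀ (by have : (0:ℝ) ≤ k := by positivity
                                                      linarith)
    calc ((J2 k).card:ℝ) ≤ K2*H k := c2 k
      _ = K2*c*1*(2:ℝ)^((1-lam)*k) := by rw [hH]; ring
      _ ≤ _ := by gcongr)
  refine measure_mono_null ?_ (measure_union_null z1 z2)
  rintro x ⟨hx, hxR⟩
  have hf := (sim_freq I lam (by linarith) x hx).and_eventually (Filter.eventually_ge_atTop k0)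
  rw [Set.mem_union, Set.mem_setOf_eq, Set.mem_setOf_eq, ← Filter.frequently_or_distrib]
  refine hf.mono ?_
  rintro k ⟨⟨p0, p1, p2, p3, b1, b2, b3, b4, b5⟩, hk⟩
  rcases cov k hk x hxR p0 p1 p2 p3 b1 b2 b3 b4 b5 with h | h
  · left
    convert h using 5
    rw [hpow, ← Real.rpow_sub (by norm_num), one_mul]
    congr 1; ring
  · right
    convert h using 5
    have e : Real.sqrt (H k) = Real.sqrt c * (2:ℝ)^((1-lam)/2*k) := by
      rw [hH, Real.sqrt_mul (by linarith), Real.sqrt_eq_rpow ((2:ℝ)^((1-lam)*k)), ← Real.rpow_mul (by norm_num)]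
      congr 2; ring
    rw [e, hpow, ← mul_assoc, mul_div_assoc, ← Real.rpow_sub (by norm_num)]
    congr 2; ring

/-- For an interval `I` and `1/2 ≤ λ ≤ 3/5`,
`dim S_3(I, λ) ≤ (4 - 2λ)/(3(1+λ))`. -/
theorem stmt4 (I : Set ℝ) (hI : I.OrdConnected)
    (lam : ℝ) (h1 : 1 / 2 ≤ lam) (h2 : lam ≤ 3 / 5) :
    dimH (SimSet 3 I lam) ≤
      ENNReal.ofReal ((4 - 2 * lam) / (3 * (1 + lam))) := by
  have hcov : SimSet 3 I lam ⊆ ⋃ R : ℕ, (SimSet 3 I lam ∩ {x | |x| ≤ ((R+1:ℕ):ℝ)}) := by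
    intro x hx
    rw [Set.mem_iUnion]
    obtain ⟨n, hn⟩ := exists_nat_ge |x|
    exact ⟨n, hx, by simp only [Set.mem_setOf_eq]; push_cast; linarith⟩
  refine (dimH_mono hcov).trans ?_
  rw [dimH_iUnion]
  refine iSup_le (fun R => ?_)
  apply dimH_le
  intro d hd
  by_contra hlt
  push Not at hlt
  have hlt2 : (4 - 2 * lam) / (3 * (1 + lam)) < (d:ℝ) := by
    have h0 : 0 ≤ (4 - 2 * lam) / (3 * (1 + lam)) := div_nonneg (by linarith) (by linarith)
    rw [← ENNReal.ofReal_coe_nnreal] at hlt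
    exact (ENNReal.ofReal_lt_ofReal_iff_of_nonneg h0).1 hlt
  have := main_R I lam h1 h2 (R+1) (by omega) d hlt2
  rw [this] at hd
  exact ENNReal.zero_ne_top hd
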